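/- Fix N ≥ 1, 0 < b < min{2,N}, and 1 + (4−2b)/N < p ≤ 1 + 4/N; set α̃ = N(p−1)/4, so 0 < α̃ ≤ 1. Let u be a classical Schwartz solution of (INLS) on an interval J, and suppose there exist constants δ₀, C₀, M₁, C₁ > 0 such that for all t ∈ J: (i) K(u(t,·)) ≤ −δ₀ ∫|∇ₓu(t,x)|² dx; (ii) ∫|∇ₓu(t,x)|² dx ≥ C₀; (iii) ∫|u(t,x)|² dx ≤ M₁; (iv) ∫|u(t,x)|^{p+1} dx ≤ C₁ (∫|∇ₓu(t,x)|² dx)^{α̃}. Let C₃ > 0 and, for R > 0, let w : [0,∞) → ℝ be of class C⁴ with w(r) = r² for r ≤ R, w(r) = 0 for r ≥ 2R, w'' ≤ 2, |w''| ≤ C₃, and such that φ(x) = w(|x|) is C⁴ with |Δ²φ| ≤ C₃/R². Then there exists R₀ > 0, depending only on N, p, b, δ₀, C₀, M₁, C₁, C₃, such that for every R ≥ R₀ the localized virial quantity I(t) = ∫ φ|u(t,·)|² dx satisfies I''(t) ≤ −4δ₀ ∫|∇ₓu(t,x)|² dx for all t ∈ J. -/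

import Mathlib

open MeasureTheory Set
open scoped BigOperators

noncomputable section

/-- The Laplacian of a complex-valued function on `ℝ^N`, computed as the sum of the repeated
directional derivatives along the standard basis vectors. -/
def lap {N : ℕ} (f : EuclideanSpace ℝ (Fin N) → ℂ) (x : EuclideanSpace ℝ (Fin N)) : ℂ :=
  ∑ i : Fin N, fderiv ℝ (fun y => fderiv ℝ f y (EuclideanSpace.single i 1)) x
      (EuclideanSpace.single i 1)

/-- The squared euclidean norm `|∇f(x)|²` of the gradient of `f : ℝ^N → ℂ` at `x`. -/
def gradNormSq {N : ℕ} (f : EuclideanSpace ℝ (Fin N) → ℂ) (x : EuclideanSpace ℝ (Fin N)) : ℝ :=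
  ∑ i : Fin N, ‖fderiv ℝ f x (EuclideanSpace.single i 1)‖ ^ 2

/-- A classical Schwartz solution of the inhomogeneous nonlinear Schrödinger equation
`i ∂ₜ u + Δu + |x|^{-b} |u|^{p-1} u = 0` on a time interval `J`:
for each time `t` the spatial profile `u t` is a Schwartz function, `u` is jointly
continuous on `J × ℝ^N`, jointly smooth on `J × (ℝ^N \ {0})`, the Schwartz seminorms of
`u t` are bounded uniformly for `t` in compact subsets of `J`, and the equation holds for
all `t ∈ J` and `x ≠ 0`. -/
structure INLSSolution (N : ℕ) (b p : ℝ) (J : Set ℝ) where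
  u : ℝ → SchwartzMap (EuclideanSpace ℝ (Fin N)) ℂ
  cont : ContinuousOn (fun q : ℝ × EuclideanSpace ℝ (Fin N) => u q.1 q.2) (J ×ˢ univ)
  smooth : ContDiffOn ℝ (⊤ : ℕ∞) (fun q : ℝ × EuclideanSpace ℝ (Fin N) => u q.1 q.2)
      (J ×ˢ {x : EuclideanSpace ℝ (Fin N) | x ≠ 0})
  seminorm_bound : ∀ K : Set ℝ, K ⊆ J → IsCompact K → ∀ k n : ℕ,
      ∃ C : ℝ, ∀ t ∈ K, SchwartzMap.seminorm ℝ k n (u t) ≤ C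
  eqn : ∀ t ∈ J, ∀ x : EuclideanSpace ℝ (Fin N), x ≠ 0 → ∃ ut' : ℂ,
      HasDerivWithinAt (fun s => u s x) ut' J t ∧
      Complex.I * ut' + lap (fun y => u t y) x +
        ((‖x‖ ^ (-b) * ‖u t x‖ ^ (p - 1) : ℝ) : ℂ) * u t x = 0

/-- The Laplacian of a real-valued function on `ℝ^N`, computed as the sum of the repeated
directional derivatives along the standard basis vectors. -/
def lapR {N : ℕ} (f : EuclideanSpace ℝ (Fin N) → ℝ) (x : EuclideanSpace ℝ (Fin N)) : ℝ :=
  ∑ i : Fin N, fderiv ℝ (fun y => fderiv ℝ f y (EuclideanSpace.single i 1)) x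
      (EuclideanSpace.single i 1)

/-- The virial functional `K(v) = ∫|∇v|² dx − ((N(p−1)+2b)/(2(p+1))) ∫ |x|^{-b}|v|^{p+1} dx`. -/
def Kq (N : ℕ) (b p : ℝ) (v : EuclideanSpace ℝ (Fin N) → ℂ) : ℝ :=
  (∫ x : EuclideanSpace ℝ (Fin N), gradNormSq v x) -
    (((N : ℝ) * (p - 1) + 2 * b) / (2 * (p + 1))) *
      ∫ x : EuclideanSpace ℝ (Fin N), ‖x‖ ^ (-b) * ‖v x‖ ^ (p + 1)

open Filter Topology

/-- The partial derivative of `f` along the `i`-th standard basis vector of `ℝ^N`. -/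
def pd {N : ℕ} {F : Type*} [NormedAddCommGroup F] [NormedSpace ℝ F] (i : Fin N)
    (f : EuclideanSpace ℝ (Fin N) → F) (x : EuclideanSpace ℝ (Fin N)) : F :=
  fderiv ℝ f x (EuclideanSpace.single i 1)

theorem hasCompactSupport_sum {N : ℕ} {F ι : Type*} [NormedAddCommGroup F]
    (s : Finset ι) {f : ι → EuclideanSpace ℝ (Fin N) → F} (hf : ∀ i ∈ s, HasCompactSupport (f i)) :
    HasCompactSupport fun x => ∑ i ∈ s, f i x := by
  have h := HasCompactSupport.finset_sum hf
  rwa [Finset.sum_fn] at h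

section PartialDerivatives

variable {N : ℕ} {F : Type*} [NormedAddCommGroup F] [NormedSpace ℝ F]

theorem lap_eq (f : EuclideanSpace ℝ (Fin N) → ℂ) (x : EuclideanSpace ℝ (Fin N)) :
    lap f x = ∑ i, pd i (pd i f) x := rfl

theorem lapR_eq (f : EuclideanSpace ℝ (Fin N) → ℝ) :
    lapR f = fun x => ∑ i, pd i (pd i f) x := rfl

theorem gradNormSq_eq (f : EuclideanSpace ℝ (Fin N) → ℂ) (x : EuclideanSpace ℝ (Fin N)) :
    gradNormSq f x = ∑ i, ‖pd i f x‖ ^ 2 := rfl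

theorem contDiff_pd {m n : WithTop ℕ∞} (i : Fin N) {f : EuclideanSpace ℝ (Fin N) → F}
    (hf : ContDiff ℝ n f) (h : m + 1 ≤ n) : ContDiff ℝ m (pd i f) :=
  (hf.fderiv_right h).clm_apply contDiff_const

theorem norm_pd_le (i : Fin N) (f : EuclideanSpace ℝ (Fin N) → F)
    (x : EuclideanSpace ℝ (Fin N)) : ‖pd i f x‖ ≤ ‖fderiv ℝ f x‖ := by
  simpa [pd] using (fderiv ℝ f x).le_opNorm (EuclideanSpace.single i (1 : ℝ))

theorem pd_inner (i : Fin N) {f g : EuclideanSpace ℝ (Fin N) → ℂ} {x : EuclideanSpace ℝ (Fin N)}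
    (hf : DifferentiableAt ℝ f x) (hg : DifferentiableAt ℝ g x) :
    pd i (fun y => inner ℝ (f y) (g y)) x =
      inner ℝ (pd i f x) (g x) + inner ℝ (f x) (pd i g x) := by
  rw [pd, fderiv_inner_apply ℝ hf hg, add_comm]
  rfl

theorem pd_mul (i : Fin N) {f g : EuclideanSpace ℝ (Fin N) → ℝ} {x : EuclideanSpace ℝ (Fin N)}
    (hf : DifferentiableAt ℝ f x) (hg : DifferentiableAt ℝ g x) :
    pd i (fun y => f y * g y) x = pd i f x * g x + f x * pd i g x := by
  simp only [pd, fderiv_fun_mul hf hg, add_apply,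
    smul_apply, smul_eq_mul]
  ring

theorem pd_smul (i : Fin N) {f : EuclideanSpace ℝ (Fin N) → ℝ}
    {g : EuclideanSpace ℝ (Fin N) → F} {x : EuclideanSpace ℝ (Fin N)}
    (hf : DifferentiableAt ℝ f x) (hg : DifferentiableAt ℝ g x) :
    pd i (fun y => f y • g y) x = pd i f x • g x + f x • pd i g x := by
  simp only [pd, fderiv_fun_smul hf hg, add_apply,
    smul_apply, ContinuousLinearMap.smulRight_apply]
  abel

theorem pd_add (i : Fin N) {f g : EuclideanSpace ℝ (Fin N) → F} {x : EuclideanSpace ℝ (Fin N)}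
    (hf : DifferentiableAt ℝ f x) (hg : DifferentiableAt ℝ g x) :
    pd i (fun y => f y + g y) x = pd i f x + pd i g x := by
  simp [pd, fderiv_fun_add hf hg]

theorem pd_sub (i : Fin N) {f g : EuclideanSpace ℝ (Fin N) → F} {x : EuclideanSpace ℝ (Fin N)}
    (hf : DifferentiableAt ℝ f x) (hg : DifferentiableAt ℝ g x) :
    pd i (fun y => f y - g y) x = pd i f x - pd i g x := by
  simp [pd, fderiv_fun_sub hf hg]

theorem pd_const_mul (i : Fin N) (c : ℂ) {f : EuclideanSpace ℝ (Fin N) → ℂ}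
    {x : EuclideanSpace ℝ (Fin N)} (hf : DifferentiableAt ℝ f x) :
    pd i (fun y => c * f y) x = c * pd i f x := by
  simp [pd, fderiv_const_mul hf c]

theorem pd_const_mul_real (i : Fin N) (c : ℝ) {f : EuclideanSpace ℝ (Fin N) → ℝ}
    {x : EuclideanSpace ℝ (Fin N)} (hf : DifferentiableAt ℝ f x) :
    pd i (fun y => c * f y) x = c * pd i f x := by
  simp [pd, fderiv_const_mul hf c]

theorem pd_sum {ι : Type*} (s : Finset ι) (i : Fin N) {f : ι → EuclideanSpace ℝ (Fin N) → F}
    {x : EuclideanSpace ℝ (Fin N)} (hf : ∀ j ∈ s, DifferentiableAt ℝ (f j) x) :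
    pd i (fun y => ∑ j ∈ s, f j y) x = ∑ j ∈ s, pd i (f j) x := by
  simp [pd, fderiv_fun_sum hf]

theorem pd_comm (i j : Fin N) {f : EuclideanSpace ℝ (Fin N) → F} (hf : ContDiff ℝ 2 f)
    (x : EuclideanSpace ℝ (Fin N)) : pd i (pd j f) x = pd j (pd i f) x := by
  have hd : DifferentiableAt ℝ (fderiv ℝ f) x :=
    (hf.fderiv_right (m := 1) (by norm_num)).differentiable (by norm_num) x
  have key : ∀ k l : Fin N, pd k (pd l f) x =
      fderiv ℝ (fderiv ℝ f) x (EuclideanSpace.single k 1) (EuclideanSpace.single l 1) := by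
    intro k l
    change fderiv ℝ (fun y => fderiv ℝ f y (EuclideanSpace.single l 1)) x _ = _
    rw [fderiv_clm_apply hd (differentiableAt_const _)]
    simp
  rw [key, key]
  exact (hf.contDiffAt.isSymmSndFDerivAt (by simp)).eq _ _

theorem hasCompactSupport_pd (i : Fin N) {f : EuclideanSpace ℝ (Fin N) → F}
    (hf : HasCompactSupport f) : HasCompactSupport (pd i f) :=
  hf.fderiv_apply (𝕜 := ℝ) _

theorem continuous_lap {f : EuclideanSpace ℝ (Fin N) → ℂ} (hf : ContDiff ℝ 2 f) :
    Continuous (lap f) :=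
  continuous_finsetSum _ fun j _ =>
    (contDiff_pd (m := 0) j (contDiff_pd (m := 1) j hf (by norm_num)) (by norm_num)).continuous

theorem contDiff_lapR {f : EuclideanSpace ℝ (Fin N) → ℝ} (hf : ContDiff ℝ 4 f) :
    ContDiff ℝ 2 (lapR f) :=
  ContDiff.sum fun j _ => contDiff_pd (m := 2) j (contDiff_pd (m := 3) j hf (by norm_num))
    (by norm_num)

theorem continuous_lapR {f : EuclideanSpace ℝ (Fin N) → ℝ} (hf : ContDiff ℝ 2 f) :
    Continuous (lapR f) :=
  continuous_finsetSum _ fun j _ =>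
    (contDiff_pd (m := 0) j (contDiff_pd (m := 1) j hf (by norm_num)) (by norm_num)).continuous

theorem hasCompactSupport_lapR {f : EuclideanSpace ℝ (Fin N) → ℝ} (hf : HasCompactSupport f) :
    HasCompactSupport (lapR f) := by
  rw [hasCompactSupport_def]
  refine (hf : IsCompact (tsupport f)).of_isClosed_subset isClosed_closure
    (closure_minimal ?_ (isClosed_tsupport f))
  intro x hx
  by_contra hxf
  refine hx (Finset.sum_eq_zero fun j _ => ?_)
  have h : tsupport (pd j (pd j f)) ⊆ tsupport f :=
    (tsupport_fderiv_apply_subset ℝ _).trans (tsupport_fderiv_apply_subset ℝ _)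
  exact image_eq_zero_of_notMem_tsupport (f := pd j (pd j f)) fun h' => hxf (h h')

theorem integral_pd_eq_zero (i : Fin N) {f : EuclideanSpace ℝ (Fin N) → ℝ}
    (hf : ContDiff ℝ 1 f) (hs : HasCompactSupport f) : ∫ x, pd i f x = 0 := by
  have h := integral_mul_fderiv_eq_neg_fderiv_mul_of_integrable (μ := volume) (f := f)
    (g := fun _ : EuclideanSpace ℝ (Fin N) => (1 : ℝ)) (v := EuclideanSpace.single i 1)
    (by simpa [pd] using!
      ((contDiff_pd (m := 0) i hf (by norm_num)).continuous).integrable_of_hasCompactSupport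
          (hasCompactSupport_pd i hs))
    (by simp) (by simpa using hf.continuous.integrable_of_hasCompactSupport hs)
    (fun x _ => hf.differentiable (by norm_num) x) (fun x _ => differentiableAt_const _)
  simpa [pd] using h

theorem integral_eq_of_eq_add_div {A B : EuclideanSpace ℝ (Fin N) → ℝ}
    {P : Fin N → EuclideanSpace ℝ (Fin N) → ℝ} (hA : Integrable A)
    (hP : ∀ j, ContDiff ℝ 1 (P j)) (hs : ∀ j, HasCompactSupport (P j))
    (h : ∀ x, A x = B x + ∑ j, pd j (P j) x) : ∫ x, A x = ∫ x, B x := by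
  have hi : ∀ j, Integrable (pd j (P j)) := fun j =>
    (contDiff_pd (m := 0) j (hP j) (by norm_num)).continuous.integrable_of_hasCompactSupport
      (hasCompactSupport_pd j (hs j))
  have hB : B = fun x => A x - ∑ j, pd j (P j) x := by
    ext x
    rw [h x]
    ring
  rw [hB, integral_sub hA (integrable_finsetSum _ fun j _ => hi j),
    integral_finsetSum _ fun j _ => hi j]
  simp [integral_pd_eq_zero _ (hP _) (hs _)]

end PartialDerivatives

section IntegrationByParts

variable {N : ℕ} {φ : EuclideanSpace ℝ (Fin N) → ℝ} {v w : EuclideanSpace ℝ (Fin N) → ℂ}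

theorem inner_I_mul_self (z : ℂ) : inner ℝ (Complex.I * z) z = 0 := by
  simp [Complex.inner]
  ring

theorem inner_I_mul_comm (z w : ℂ) :
    inner ℝ (Complex.I * z) w = -inner ℝ (Complex.I * w) z := by
  simp [Complex.inner]
  ring

theorem integral_mul_inner_I_lap (hφ : ContDiff ℝ 4 φ) (hs : HasCompactSupport φ)
    (hv : ContDiff ℝ 4 v) :
    ∫ x, φ x * inner ℝ (Complex.I * lap v x) (v x) =
      ∫ x, -∑ j, pd j φ x * inner ℝ (Complex.I * pd j v x) (v x) := by
  have hv1 : ∀ j, ContDiff ℝ 3 (pd j v) := fun j => contDiff_pd j hv (by norm_num)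
  have hI : ∀ j, ContDiff ℝ 3 (fun x => Complex.I * pd j v x) := fun j => contDiff_const.mul (hv1 j)
  have hin : ∀ j, ContDiff ℝ 3 (fun x => inner ℝ (Complex.I * pd j v x) (v x)) := fun j =>
    (hI j).inner ℝ (hv.of_le (by norm_num))
  refine integral_eq_of_eq_add_div (P := fun j x => φ x * inner ℝ (Complex.I * pd j v x) (v x))
    ?_ ?_ ?_ ?_
  · refine Continuous.integrable_of_hasCompactSupport ?_ hs.mul_right
    refine hφ.continuous.mul (Continuous.inner (continuous_const.mul ?_) hv.continuous)
    exact continuous_lap (hv.of_le (by norm_num))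
  · exact fun j => (hφ.of_le (by norm_num)).mul ((hin j).of_le (by norm_num))
  · exact fun j => hs.mul_right
  · intro x
    have key : ∀ j, pd j (fun x => φ x * inner ℝ (Complex.I * pd j v x) (v x)) x =
        pd j φ x * inner ℝ (Complex.I * pd j v x) (v x)
          + φ x * inner ℝ (Complex.I * pd j (pd j v) x) (v x) := by
      intro j
      have e1 : DifferentiableAt ℝ φ x := hφ.differentiable (by norm_num) x
      have e2 := (hin j).differentiable (by norm_num) x
      have e3 := (hI j).differentiable (by norm_num) x
      have e4 := hv.differentiable (by norm_num) x
      rw [pd_mul j e1 e2, pd_inner j e3 e4,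
        pd_const_mul j _ ((hv1 j).differentiable (by norm_num) x), inner_I_mul_self, add_zero]
    simp only [key, lap_eq, Finset.mul_sum, sum_inner, Finset.sum_add_distrib]
    ring

theorem integral_sum_mul_inner_I_pd (hφ : ContDiff ℝ 4 φ) (hs : HasCompactSupport φ)
    (hv : ContDiff ℝ 4 v) (hw : ContDiff ℝ 4 w) :
    ∫ x, ∑ j, pd j φ x * inner ℝ (Complex.I * pd j w x) (v x) =
      ∫ x, -inner ℝ (Complex.I * w x) (lapR φ x • v x + ∑ j, pd j φ x • pd j v x) := by
  have hv1 : ∀ j, ContDiff ℝ 3 (pd j v) := fun j => contDiff_pd j hv (by norm_num)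
  have hw1 : ∀ j, ContDiff ℝ 3 (pd j w) := fun j => contDiff_pd j hw (by norm_num)
  have hφ1 : ∀ j, ContDiff ℝ 3 (pd j φ) := fun j => contDiff_pd j hφ (by norm_num)
  have hI : ContDiff ℝ 4 (fun x => Complex.I * w x) := contDiff_const.mul hw
  have hin : ContDiff ℝ 4 (fun x => inner ℝ (Complex.I * w x) (v x)) := hI.inner ℝ hv
  refine integral_eq_of_eq_add_div (P := fun j x => pd j φ x * inner ℝ (Complex.I * w x) (v x))
    ?_ ?_ ?_ ?_
  · refine integrable_finsetSum _ fun j _ =>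
      Continuous.integrable_of_hasCompactSupport ?_ (hasCompactSupport_pd j hs).mul_right
    exact (hφ1 j).continuous.mul
      (Continuous.inner (continuous_const.mul (hw1 j).continuous) hv.continuous)
  · exact fun j => ((hφ1 j).of_le (by norm_num)).mul (hin.of_le (by norm_num))
  · exact fun j => (hasCompactSupport_pd j hs).mul_right
  · intro x
    have key : ∀ j, pd j (fun x => pd j φ x * inner ℝ (Complex.I * w x) (v x)) x =
        pd j (pd j φ) x * inner ℝ (Complex.I * w x) (v x)
          + (pd j φ x * inner ℝ (Complex.I * pd j w x) (v x)
            + pd j φ x * inner ℝ (Complex.I * w x) (pd j v x)) := by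
      intro j
      have e3 := hI.differentiable (by norm_num) x
      have e4 := hv.differentiable (by norm_num) x
      rw [pd_mul j ((hφ1 j).differentiable (by norm_num) x) (hin.differentiable (by norm_num) x),
        pd_inner j e3 e4, pd_const_mul j _ (hw.differentiable (by norm_num) x)]
      ring
    simp only [key, lapR_eq, inner_add_right, inner_smul_right, inner_sum, Finset.sum_add_distrib,
      Finset.sum_mul]
    ring

theorem integral_momentum_sub (hφ : ContDiff ℝ 4 φ) (hs : HasCompactSupport φ)
    (hv : ContDiff ℝ 4 v) (hw : ContDiff ℝ 4 w) :
    (∫ x, ∑ j, pd j φ x * inner ℝ (Complex.I * pd j v x) (v x)) -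
        ∫ x, ∑ j, pd j φ x * inner ℝ (Complex.I * pd j w x) (w x) =
      ∫ x, -inner ℝ (Complex.I * (v x - w x))
        (lapR φ x • v x + ∑ j, pd j φ x • (pd j v x + pd j w x)) := by
  have hφ1 : ∀ j, ContDiff ℝ 3 (pd j φ) := fun j => contDiff_pd j hφ (by norm_num)
  have hint : ∀ {f g : EuclideanSpace ℝ (Fin N) → ℂ}, ContDiff ℝ 4 f → ContDiff ℝ 4 g →
      Integrable fun x => ∑ j, pd j φ x * inner ℝ (Complex.I * pd j f x) (g x) := by
    intro f g hf hg
    refine integrable_finsetSum _ fun j _ =>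
      Continuous.integrable_of_hasCompactSupport ?_ (hasCompactSupport_pd j hs).mul_right
    exact (hφ1 j).continuous.mul (Continuous.inner (continuous_const.mul
      (contDiff_pd (m := 3) j hf (by norm_num)).continuous) hg.continuous)
  have hd : ContDiff ℝ 4 (fun x => v x - w x) := hv.sub hw
  have h1 := integral_sum_mul_inner_I_pd hφ hs hv hd
  have hdj : ∀ j x, pd j (fun x => v x - w x) x = pd j v x - pd j w x := fun j x =>
    pd_sub j (hv.differentiable (by norm_num) x) (hw.differentiable (by norm_num) x)
  have hrest : Integrable fun x => ∑ j, pd j φ x * inner ℝ (Complex.I * pd j w x) (v x - w x) :=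
    hint hw hd
  have hsplit : ∀ x, ∑ j, pd j φ x * inner ℝ (Complex.I * pd j v x) (v x) -
      ∑ j, pd j φ x * inner ℝ (Complex.I * pd j w x) (w x) =
      ∑ j, pd j φ x * inner ℝ (Complex.I * pd j (fun x => v x - w x) x) (v x) +
      ∑ j, pd j φ x * inner ℝ (Complex.I * pd j w x) (v x - w x) := by
    intro x
    rw [← Finset.sum_sub_distrib, ← Finset.sum_add_distrib]
    refine Finset.sum_congr rfl fun j _ => ?_
    rw [hdj, mul_sub Complex.I, inner_sub_left, inner_sub_right]
    ring
  rw [← integral_sub (hint hv hv) (hint hw hw)]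
  simp only [hsplit]
  rw [integral_add (hint hd hv) hrest, h1, ← integral_add _ hrest]
  · congr 1
    ext x
    have : ∑ j, pd j φ x * inner ℝ (Complex.I * pd j w x) (v x - w x) =
        -inner ℝ (Complex.I * (v x - w x)) (∑ j, pd j φ x • pd j w x) := by
      rw [inner_sum, ← Finset.sum_neg_distrib]
      refine Finset.sum_congr rfl fun j _ => ?_
      rw [inner_I_mul_comm, inner_smul_right]
      ring
    rw [this]
    simp only [inner_add_right, smul_add, Finset.sum_add_distrib]
    ring
  · simp only [inner_add_right, inner_smul_right, inner_sum]
    refine ((Continuous.integrable_of_hasCompactSupport ?_ ?_).add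
      (integrable_finsetSum _ fun j _ => Continuous.integrable_of_hasCompactSupport ?_ ?_)).neg
    · exact (contDiff_lapR hφ).continuous.mul
        (Continuous.inner (continuous_const.mul hd.continuous) hv.continuous)
    · exact (hasCompactSupport_lapR hs).mul_right
    · exact (hφ1 j).continuous.mul (Continuous.inner (continuous_const.mul hd.continuous)
        (contDiff_pd (m := 3) j hv (by norm_num)).continuous)
    · exact (hasCompactSupport_pd j hs).mul_right

theorem pd_virialFlux (hφ : ContDiff ℝ 4 φ) (hv : ContDiff ℝ 4 v) (j : Fin N)
    (x : EuclideanSpace ℝ (Fin N)) :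
    pd j (fun x => -2 * (lapR φ x * inner ℝ (pd j v x) (v x))
        + pd j (lapR φ) x * inner ℝ (v x) (v x)
        + -4 * inner ℝ (pd j v x) (∑ i, pd i φ x • pd i v x)
        + 2 * (pd j φ x * ∑ i, inner ℝ (pd i v x) (pd i v x))) x =
      -2 * (pd j (lapR φ) x * inner ℝ (pd j v x) (v x)
          + lapR φ x * (inner ℝ (pd j (pd j v) x) (v x) + inner ℝ (pd j v x) (pd j v x)))
        + (pd j (pd j (lapR φ)) x * inner ℝ (v x) (v x)
          + pd j (lapR φ) x * (inner ℝ (pd j v x) (v x) + inner ℝ (v x) (pd j v x)))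
        + -4 * (inner ℝ (pd j (pd j v) x) (∑ i, pd i φ x • pd i v x)
          + inner ℝ (pd j v x)
            (∑ i, (pd j (pd i φ) x • pd i v x + pd i φ x • pd j (pd i v) x)))
        + 2 * (pd j (pd j φ) x * ∑ i, inner ℝ (pd i v x) (pd i v x)
          + pd j φ x * ∑ i, (inner ℝ (pd j (pd i v) x) (pd i v x)
            + inner ℝ (pd i v x) (pd j (pd i v) x))) := by
  have dv := hv.differentiable (by norm_num) x
  have dv1 : ∀ i, DifferentiableAt ℝ (pd i v) x := fun i =>
    (contDiff_pd (m := 3) i hv (by norm_num)).differentiable (by norm_num) x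
  have dφ1 : ∀ i, DifferentiableAt ℝ (pd i φ) x := fun i =>
    (contDiff_pd (m := 3) i hφ (by norm_num)).differentiable (by norm_num) x
  have dl : DifferentiableAt ℝ (lapR φ) x := (contDiff_lapR hφ).differentiable (by norm_num) x
  have dl1 : DifferentiableAt ℝ (pd j (lapR φ)) x :=
    (contDiff_pd (m := 1) j (contDiff_lapR hφ) (by norm_num)).differentiable (by norm_num) x
  have dW : DifferentiableAt ℝ (fun x => ∑ i, pd i φ x • pd i v x) x :=
    DifferentiableAt.fun_sum fun i _ => (dφ1 i).smul (dv1 i)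
  have dG : DifferentiableAt ℝ (fun x => ∑ i, inner ℝ (pd i v x) (pd i v x)) x :=
    DifferentiableAt.fun_sum fun i _ => (dv1 i).inner ℝ (dv1 i)
  have d1 : DifferentiableAt ℝ (fun x => lapR φ x * inner ℝ (pd j v x) (v x)) x :=
    dl.mul ((dv1 j).inner ℝ dv)
  have d2 : DifferentiableAt ℝ (fun x => pd j (lapR φ) x * inner ℝ (v x) (v x)) x :=
    dl1.mul (dv.inner ℝ dv)
  have d3 : DifferentiableAt ℝ (fun x => inner ℝ (pd j v x) (∑ i, pd i φ x • pd i v x)) x :=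
    (dv1 j).inner ℝ dW
  have d4 : DifferentiableAt ℝ (fun x => pd j φ x * ∑ i, inner ℝ (pd i v x) (pd i v x)) x :=
    (dφ1 j).mul dG
  rw [pd_add j (((d1.const_mul _).fun_add d2).fun_add (d3.const_mul _)) (d4.const_mul _),
    pd_add j ((d1.const_mul _).fun_add d2) (d3.const_mul _), pd_add j (d1.const_mul _) d2,
    pd_const_mul_real j _ d1, pd_const_mul_real j _ d3, pd_const_mul_real j _ d4,
    pd_mul j dl ((dv1 j).inner ℝ dv), pd_inner j (dv1 j) dv, pd_mul j dl1 (dv.inner ℝ dv),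
    pd_inner j dv dv, pd_inner j (dv1 j) dW, pd_mul j (dφ1 j) dG,
    pd_sum _ j fun i _ => (dφ1 i).fun_smul (dv1 i), pd_sum _ j fun i _ => (dv1 i).inner ℝ (dv1 i)]
  simp only [pd_smul j (dφ1 _) (dv1 _), pd_inner j (dv1 _) (dv1 _)]

theorem integral_inner_lap_dilation (hφ : ContDiff ℝ 4 φ) (hs : HasCompactSupport φ)
    (hv : ContDiff ℝ 4 v) :
    ∫ x, -2 * inner ℝ (lap v x) (lapR φ x • v x + ∑ j, pd j φ x • (pd j v x + pd j v x)) =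
      ∫ x, (4 * ∑ j, ∑ i, pd j (pd i φ) x * inner ℝ (pd j v x) (pd i v x)
        - lapR (lapR φ) x * ‖v x‖ ^ 2) := by
  have hv1 : ∀ j, ContDiff ℝ 3 (pd j v) := fun j => contDiff_pd j hv (by norm_num)
  have hφ1 : ∀ j, ContDiff ℝ 3 (pd j φ) := fun j => contDiff_pd j hφ (by norm_num)
  have hW : ContDiff ℝ 1 (fun x => ∑ i, pd i φ x • pd i v x) :=
    ContDiff.sum fun i _ => ((hφ1 i).smul (hv1 i)).of_le (by norm_num)
  have hG : ContDiff ℝ 1 (fun x => ∑ i, inner ℝ (pd i v x) (pd i v x)) :=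
    ContDiff.sum fun i _ => ((hv1 i).inner ℝ (hv1 i)).of_le (by norm_num)
  refine integral_eq_of_eq_add_div
    (P := fun j x => -2 * (lapR φ x * inner ℝ (pd j v x) (v x))
        + pd j (lapR φ) x * inner ℝ (v x) (v x)
        + -4 * inner ℝ (pd j v x) (∑ i, pd i φ x • pd i v x)
        + 2 * (pd j φ x * ∑ i, inner ℝ (pd i v x) (pd i v x))) ?_ ?_ ?_ ?_
  · simp only [inner_add_right, inner_smul_right, inner_sum]
    have hl := continuous_lap (hv.of_le (by norm_num) : ContDiff ℝ 2 v)
    refine ((Continuous.integrable_of_hasCompactSupport ?_ ?_).add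
      (integrable_finsetSum _ fun j _ =>
        Continuous.integrable_of_hasCompactSupport ?_ ?_)).const_mul _
    · exact (contDiff_lapR hφ).continuous.mul (hl.inner hv.continuous)
    · exact (hasCompactSupport_lapR hs).mul_right
    · exact (hφ1 j).continuous.mul ((hl.inner (hv1 j).continuous).add (hl.inner (hv1 j).continuous))
    · exact (hasCompactSupport_pd j hs).mul_right
  · intro j
    refine ContDiff.add (ContDiff.add (ContDiff.add (contDiff_const.mul ?_) ?_)
      (contDiff_const.mul ?_)) (contDiff_const.mul ?_)
    · exact ((contDiff_lapR hφ).of_le (by norm_num)).mul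
        ((((hv1 j)).of_le (by norm_num)).inner ℝ (hv.of_le (by norm_num)))
    · exact (contDiff_pd j (contDiff_lapR hφ) (by norm_num)).mul
        ((hv.inner ℝ hv).of_le (by norm_num))
    · exact ((hv1 j).of_le (by norm_num)).inner ℝ hW
    · exact ((hφ1 j).of_le (by norm_num)).mul hG
  · intro j
    have h3 : HasCompactSupport fun x => inner ℝ (pd j v x) (∑ i, pd i φ x • pd i v x) := by
      simp only [inner_sum, inner_smul_right]
      exact hasCompactSupport_sum _ fun i _ => (hasCompactSupport_pd i hs).mul_right
    have h1 : HasCompactSupport fun x => lapR φ x * inner ℝ (pd j v x) (v x) :=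
      (hasCompactSupport_lapR hs).mul_right
    have h2 : HasCompactSupport fun x => pd j (lapR φ) x * inner ℝ (v x) (v x) :=
      (hasCompactSupport_pd j (hasCompactSupport_lapR hs)).mul_right
    have h4 : HasCompactSupport fun x => pd j φ x * ∑ i, inner ℝ (pd i v x) (pd i v x) :=
      (hasCompactSupport_pd j hs).mul_right
    have h1' : HasCompactSupport fun x => -2 * (lapR φ x * inner ℝ (pd j v x) (v x)) := h1.mul_left
    have h3' : HasCompactSupport fun x =>
        -4 * inner ℝ (pd j v x) (∑ i, pd i φ x • pd i v x) := h3.mul_left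
    have h4' : HasCompactSupport fun x =>
        2 * (pd j φ x * ∑ i, inner ℝ (pd i v x) (pd i v x)) := h4.mul_left
    exact ((h1'.add h2).add h3').add h4'
  · intro x
    simp only [pd_virialFlux hφ hv]
    have hswap : ∑ j, pd j φ x * ∑ i, (inner ℝ (pd j (pd i v) x) (pd i v x)
          + inner ℝ (pd i v x) (pd j (pd i v) x)) =
        2 * ∑ j, ∑ i, pd i φ x * inner ℝ (pd j v x) (pd j (pd i v) x) := by
      simp only [Finset.mul_sum]
      rw [Finset.sum_comm]
      refine Finset.sum_congr rfl fun j _ => Finset.sum_congr rfl fun i _ => ?_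
      rw [pd_comm i j (hv.of_le (by norm_num)), real_inner_comm]
      ring
    have hll : lapR (lapR φ) x = ∑ j, pd j (pd j (lapR φ)) x := rfl
    have hl : ∑ j, pd j (pd j φ) x = lapR φ x := rfl
    have hc : ∀ j, inner ℝ (v x) (pd j v x) = inner ℝ (pd j v x) (v x) := fun j =>
      real_inner_comm _ _
    simp only [Finset.sum_add_distrib, ← Finset.mul_sum, ← Finset.sum_mul, inner_sum,
      inner_add_right, inner_smul_right, hll, hl, lap_eq, sum_inner, hc, mul_add,
      real_inner_self_eq_norm_sq] at hswap ⊢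
    have hswap' : ∑ j, ∑ i, pd i φ x * inner ℝ (pd j (pd j v) x) (pd i v x) =
        ∑ j, pd j φ x * ∑ i, inner ℝ (pd i (pd i v) x) (pd j v x) := by
      rw [Finset.sum_comm]
      simp only [Finset.mul_sum]
    linear_combination (-2) * hswap + 4 * hswap'

theorem integral_weight_mul_pd (hφ : ContDiff ℝ 4 φ) (hs : HasCompactSupport φ)
    {ρ g : EuclideanSpace ℝ (Fin N) → ℝ} (hρ : ContDiff ℝ 1 ρ) (hg : ContDiff ℝ 1 g) :
    ∫ x, ρ x * ∑ j, pd j φ x * pd j g x =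
      ∫ x, -(g x * (ρ x * lapR φ x + ∑ j, pd j φ x * pd j ρ x)) := by
  have hφ1 : ∀ j, ContDiff ℝ 3 (pd j φ) := fun j => contDiff_pd j hφ (by norm_num)
  have hφ1' : ∀ j, ContDiff ℝ 1 (pd j φ) := fun j => (hφ1 j).of_le (by norm_num)
  refine integral_eq_of_eq_add_div (P := fun j x => pd j φ x * (ρ x * g x)) ?_ ?_ ?_ ?_
  · simp only [Finset.mul_sum]
    refine integrable_finsetSum _ fun j _ => Continuous.integrable_of_hasCompactSupport
      (hρ.continuous.mul ((hφ1 j).continuous.mul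
        (contDiff_pd (m := 0) j hg (by norm_num)).continuous))
      (hasCompactSupport_pd j hs).mul_right.mul_left
  · exact fun j => (hφ1' j).mul (hρ.mul hg)
  · exact fun j => (hasCompactSupport_pd j hs).mul_right
  · intro x
    have dρ := hρ.differentiable (by norm_num) x
    have dg := hg.differentiable (by norm_num) x
    have key : ∀ j, pd j (fun x => pd j φ x * (ρ x * g x)) x =
        pd j (pd j φ) x * (ρ x * g x) + (g x * (pd j φ x * pd j ρ x)
          + ρ x * (pd j φ x * pd j g x)) := by
      intro j
      rw [pd_mul j ((hφ1 j).differentiable (by norm_num) x) (dρ.fun_mul dg), pd_mul j dρ dg]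
      ring
    simp only [key, lapR_eq, Finset.sum_add_distrib, ← Finset.sum_mul, ← Finset.mul_sum]
    ring

end IntegrationByParts

section Radial

variable {N : ℕ} {x : EuclideanSpace ℝ (Fin N)}

theorem pd_comp_norm (j : Fin N) {f : ℝ → ℝ} {f' : ℝ} (hx : x ≠ 0)
    (hf : HasDerivAt f f' ‖x‖) :
    pd j (fun y : EuclideanSpace ℝ (Fin N) => f ‖y‖) x = f' / ‖x‖ * x j := by
  have h0 : ‖x‖ ≠ 0 := norm_ne_zero_iff.mpr hx
  have h1 : HasFDerivAt (fun y : EuclideanSpace ℝ (Fin N) => ‖y‖ ^ 2) (2 • innerSL ℝ x) x :=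
    (hasStrictFDerivAt_norm_sq x).hasFDerivAt
  have h2 := h1.sqrt (by positivity)
  simp only [Real.sqrt_sq (norm_nonneg _)] at h2
  have h3 : HasFDerivAt (fun y : EuclideanSpace ℝ (Fin N) => f ‖y‖) _ x := hf.comp_hasFDerivAt x h2
  rw [pd, h3.fderiv]
  simp [EuclideanSpace.inner_single_right]
  field_simp

theorem pd_coord (i j : Fin N) :
    pd i (fun y : EuclideanSpace ℝ (Fin N) => y j) x = if i = j then 1 else 0 := by
  have h : HasFDerivAt (fun y : EuclideanSpace ℝ (Fin N) => y j)
      (EuclideanSpace.proj j : EuclideanSpace ℝ (Fin N) →L[ℝ] ℝ) x :=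
    (EuclideanSpace.proj j : EuclideanSpace ℝ (Fin N) →L[ℝ] ℝ).hasFDerivAt
  rw [pd, h.fderiv]
  simp [eq_comm]

theorem pd_pd_comp_norm (i j : Fin N) {f : ℝ → ℝ} (hf : ContDiff ℝ 2 f) (hx : x ≠ 0) :
    pd i (pd j (fun y : EuclideanSpace ℝ (Fin N) => f ‖y‖)) x =
      (deriv (deriv f) ‖x‖ - deriv f ‖x‖ / ‖x‖) / ‖x‖ ^ 2 * (x i * x j) +
        deriv f ‖x‖ / ‖x‖ * if i = j then 1 else 0 := by
  have h0 : ‖x‖ ≠ 0 := norm_ne_zero_iff.mpr hx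
  have hfd : Differentiable ℝ f := hf.differentiable (by norm_num)
  have hf' : ContDiff ℝ 1 (deriv f) := by
    have h : ContDiff ℝ (1 + 1) f := hf.of_le (by norm_num)
    exact (contDiff_succ_iff_deriv.mp h).2.2
  have heq : pd j (fun y : EuclideanSpace ℝ (Fin N) => f ‖y‖) =ᶠ[𝓝 x]
      fun y => (fun r => deriv f r / r) ‖y‖ * y j := by
    filter_upwards [isOpen_ne.mem_nhds hx] with y hy
    exact pd_comp_norm j hy (hfd _).hasDerivAt
  have hq : HasDerivAt (fun r => deriv f r / r)
      ((deriv (deriv f) ‖x‖ * ‖x‖ - deriv f ‖x‖ * 1) / ‖x‖ ^ 2) ‖x‖ :=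
    ((hf'.differentiable (by norm_num) _).hasDerivAt).div (hasDerivAt_id _) h0
  have hqd : DifferentiableAt ℝ
      (fun y : EuclideanSpace ℝ (Fin N) => (fun r => deriv f r / r) ‖y‖) x :=
    hq.differentiableAt.comp x ((contDiffAt_norm ℝ hx (n := 1)).differentiableAt (by norm_num))
  have hcd : DifferentiableAt ℝ (fun y : EuclideanSpace ℝ (Fin N) => y j) x :=
    (EuclideanSpace.proj j : EuclideanSpace ℝ (Fin N) →L[ℝ] ℝ).differentiableAt
  rw [pd, heq.fderiv_eq]
  change pd i (fun y : EuclideanSpace ℝ (Fin N) => (fun r => deriv f r / r) ‖y‖ * y j) x = _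
  rw [pd_mul i hqd hcd, pd_comp_norm i hx hq, pd_coord]
  congr 1
  field_simp

theorem lapR_comp_norm {f : ℝ → ℝ} (hf : ContDiff ℝ 2 f) (hx : x ≠ 0) :
    lapR (fun y : EuclideanSpace ℝ (Fin N) => f ‖y‖) x =
      deriv (deriv f) ‖x‖ + (N - 1) * (deriv f ‖x‖ / ‖x‖) := by
  have h0 : ‖x‖ ≠ 0 := norm_ne_zero_iff.mpr hx
  simp only [lapR_eq, pd_pd_comp_norm _ _ hf hx, Finset.sum_add_distrib, ← Finset.mul_sum]
  have : ∑ i, x i * x i = ‖x‖ ^ 2 := by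
    rw [EuclideanSpace.real_norm_sq_eq]
    simp [sq]
  rw [this]
  simp
  field_simp
  ring

theorem norm_sum_smul_sq_le (x : EuclideanSpace ℝ (Fin N)) (z : Fin N → ℂ) :
    ‖∑ j, x j • z j‖ ^ 2 ≤ ‖x‖ ^ 2 * ∑ j, ‖z j‖ ^ 2 := by
  have h1 : ‖∑ j, x j • z j‖ ≤ ∑ j, |x j| * ‖z j‖ :=
    (norm_sum_le _ _).trans (Finset.sum_le_sum fun j _ => by rw [norm_smul, Real.norm_eq_abs])
  calc ‖∑ j, x j • z j‖ ^ 2 ≤ (∑ j, |x j| * ‖z j‖) ^ 2 := by gcongr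
    _ ≤ (∑ j, |x j| ^ 2) * ∑ j, ‖z j‖ ^ 2 := Finset.sum_mul_sq_le_sq_mul_sq _ _ _
    _ = ‖x‖ ^ 2 * ∑ j, ‖z j‖ ^ 2 := by
      rw [EuclideanSpace.real_norm_sq_eq]
      simp

theorem sum_hessian_comp_norm_le {f : ℝ → ℝ} (hf : ContDiff ℝ 2 f) (hx : x ≠ 0)
    (h1 : deriv (deriv f) ‖x‖ ≤ 2) (h2 : deriv f ‖x‖ / ‖x‖ ≤ 2) (z : Fin N → ℂ) :
    ∑ j, ∑ i, pd j (pd i (fun y : EuclideanSpace ℝ (Fin N) => f ‖y‖)) x * inner ℝ (z j) (z i) ≤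
      2 * ∑ j, ‖z j‖ ^ 2 := by
  have h0 : 0 < ‖x‖ := norm_pos_iff.mpr hx
  set a := deriv (deriv f) ‖x‖
  set h := deriv f ‖x‖ / ‖x‖
  have e1 : ∑ j, ∑ i, x j * x i * inner ℝ (z j) (z i) = ‖∑ j, x j • z j‖ ^ 2 := by
    rw [← real_inner_self_eq_norm_sq]
    simp only [sum_inner, inner_sum, inner_smul_left, inner_smul_right, Finset.mul_sum]
    refine Finset.sum_congr rfl fun j _ => Finset.sum_congr rfl fun i _ => ?_
    simp
    ring
  have e2 : ∑ j, ∑ i, pd j (pd i (fun y : EuclideanSpace ℝ (Fin N) => f ‖y‖)) x *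
      inner ℝ (z j) (z i) =
      (a - h) / ‖x‖ ^ 2 * ‖∑ j, x j • z j‖ ^ 2 + h * ∑ j, ‖z j‖ ^ 2 := by
    rw [← e1]
    simp only [pd_pd_comp_norm _ _ hf hx, add_mul, Finset.sum_add_distrib, Finset.mul_sum]
    congr 1
    · refine Finset.sum_congr rfl fun j _ => Finset.sum_congr rfl fun i _ => ?_
      ring
    · refine Finset.sum_congr rfl fun j _ => ?_
      simp only [mul_ite, ite_mul, mul_one, mul_zero, zero_mul, Finset.sum_ite_eq,
        Finset.mem_univ, if_true, real_inner_self_eq_norm_sq, h]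
  have hcs := norm_sum_smul_sq_le x z
  set S := ∑ j, ‖z j‖ ^ 2
  set T := ‖∑ j, x j • z j‖ ^ 2
  have hT : T / ‖x‖ ^ 2 ≤ S := by
    rw [div_le_iff₀ (by positivity)]
    linarith
  have hT0 : 0 ≤ T / ‖x‖ ^ 2 := by positivity
  rw [e2]
  have : (a - h) / ‖x‖ ^ 2 * T = (a - h) * (T / ‖x‖ ^ 2) := by ring
  rw [this]
  nlinarith

theorem deriv_eq_of_eqOn_Icc {f g : ℝ → ℝ} {R r g' : ℝ} (hR : 0 < R)
    (hf : Differentiable ℝ f) (hg : HasDerivAt g g' r) (h : EqOn f g (Icc 0 R))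
    (hr : r ∈ Icc 0 R) : deriv f r = g' := by
  have h1 : HasDerivWithinAt f g' (Icc 0 R) r := hg.hasDerivWithinAt.congr h (h hr)
  exact (uniqueDiffOn_Icc hR r hr).eq_deriv _ (hf r).hasDerivAt.hasDerivWithinAt h1

theorem cutoff_deriv {w : ℝ → ℝ} {R r : ℝ} (hR : 0 < R) (hw : ContDiff ℝ 4 w)
    (h : ∀ r ∈ Icc (0 : ℝ) R, w r = r ^ 2) (hr : r ∈ Icc 0 R) : deriv w r = 2 * r := by
  refine deriv_eq_of_eqOn_Icc hR (hw.differentiable (by norm_num)) ?_ h hr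
  simpa using hasDerivAt_pow 2 r

theorem contDiff_deriv_cutoff {w : ℝ → ℝ} (hw : ContDiff ℝ 4 w) : ContDiff ℝ 3 (deriv w) := by
  have h : ContDiff ℝ (3 + 1) w := hw.of_le (by norm_num)
  exact (contDiff_succ_iff_deriv.mp h).2.2

theorem cutoff_deriv_deriv {w : ℝ → ℝ} {R r : ℝ} (hR : 0 < R) (hw : ContDiff ℝ 4 w)
    (h : ∀ r ∈ Icc (0 : ℝ) R, w r = r ^ 2) (hr : r ∈ Icc 0 R) : deriv (deriv w) r = 2 := by
  refine deriv_eq_of_eqOn_Icc hR ((contDiff_deriv_cutoff hw).differentiable (by norm_num)) ?_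
    (fun s hs => cutoff_deriv hR hw h hs) hr
  simpa using (hasDerivAt_id r).const_mul 2

theorem cutoff_deriv_le {w : ℝ → ℝ} {R r : ℝ} (hR : 0 < R) (hw : ContDiff ℝ 4 w)
    (h : ∀ r ∈ Icc (0 : ℝ) R, w r = r ^ 2) (h2 : ∀ r, 0 ≤ r → deriv (deriv w) r ≤ 2)
    (hr : 0 ≤ r) : deriv w r ≤ 2 * r := by
  have hd : Differentiable ℝ (deriv w) := (contDiff_deriv_cutoff hw).differentiable (by norm_num)
  have h0 := cutoff_deriv hR hw h (left_mem_Icc.mpr hR.le)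
  have := (convex_Ici (0 : ℝ)).image_sub_le_mul_sub_of_deriv_le hd.continuous.continuousOn
    hd.differentiableOn (C := 2) (fun y hy => h2 y (interior_subset hy)) 0 self_mem_Ici r hr hr
  linarith

theorem abs_cutoff_deriv_le {w : ℝ → ℝ} {R r C : ℝ} (hR : 0 < R) (hw : ContDiff ℝ 4 w)
    (h : ∀ r ∈ Icc (0 : ℝ) R, w r = r ^ 2) (h2 : ∀ r, 0 ≤ r → |deriv (deriv w) r| ≤ C)
    (hr : 0 ≤ r) : |deriv w r| ≤ C * r := by
  have hd : Differentiable ℝ (deriv w) := (contDiff_deriv_cutoff hw).differentiable (by norm_num)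
  have h0 := cutoff_deriv hR hw h (left_mem_Icc.mpr hR.le)
  have := (convex_Ici (0 : ℝ)).norm_image_sub_le_of_norm_deriv_le (fun y _ => hd y)
    (fun y hy => h2 y hy) self_mem_Ici (mem_Ici.mpr hr)
  simpa [h0, abs_of_nonneg hr] using this

theorem hasCompactSupport_cutoff {w : ℝ → ℝ} {R : ℝ} (h : ∀ r, 2 * R ≤ r → w r = 0) :
    HasCompactSupport fun y : EuclideanSpace ℝ (Fin N) => w ‖y‖ := by
  refine HasCompactSupport.intro (isCompact_closedBall 0 (2 * R)) fun y hy => h _ ?_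
  rw [mem_closedBall_zero_iff, not_le] at hy
  exact hy.le

end Radial

section Integrability

variable {N : ℕ} {b : ℝ}

theorem ae_ne_zero (hN : 1 ≤ N) : ∀ᵐ x : EuclideanSpace ℝ (Fin N), x ≠ 0 := by
  have : Nonempty (Fin N) := ⟨⟨0, hN⟩⟩
  exact Measure.ae_ne volume 0

theorem integrableOn_norm_rpow_neg (hN : 1 ≤ N) (hb : b < N) (r : ℝ) :
    IntegrableOn (fun x : EuclideanSpace ℝ (Fin N) => ‖x‖ ^ (-b)) (Metric.closedBall 0 r) := by
  have : Nonempty (Fin N) := ⟨⟨0, hN⟩⟩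
  have h : Integrable (fun x : EuclideanSpace ℝ (Fin N) =>
      (Iic r).indicator (fun s : ℝ => s ^ (-b)) ‖x‖) := by
    rw [integrable_fun_norm_addHaar volume (f := (Iic r).indicator (fun s : ℝ => s ^ (-b)))]
    rcases le_or_gt r 0 with hr | hr
    · refine integrableOn_zero.congr_fun (fun s hs => ?_) measurableSet_Ioi
      have : s ∉ Iic r := fun h' => absurd (lt_of_lt_of_le hs h') (not_lt.mpr hr)
      simp [this]
    have h1 : IntervalIntegrable (fun s : ℝ => s ^ ((N : ℝ) - 1 - b)) volume 0 r :=
      intervalIntegral.intervalIntegrable_rpow' (by linarith)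
    rw [intervalIntegrable_iff_integrableOn_Ioc_of_le hr.le] at h1
    have h2 : IntegrableOn ((Ioc 0 r).indicator fun s : ℝ => s ^ ((N : ℝ) - 1 - b)) (Ioi 0) :=
      (h1.integrable_indicator measurableSet_Ioc).integrableOn
    refine h2.congr_fun (fun s hs => ?_) measurableSet_Ioi
    by_cases hsr : s ≤ r
    · have hs' : (0 : ℝ) < s := hs
      simp only [indicator_of_mem (show s ∈ Ioc 0 r from ⟨hs, hsr⟩),
        indicator_of_mem (show s ∈ Iic r from hsr), finrank_euclideanSpace, Fintype.card_fin,
        smul_eq_mul]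
      rw [← Real.rpow_natCast, ← Real.rpow_add hs', Nat.cast_sub hN]
      congr 1
      push_cast
      ring
    · simp [hsr]
  rw [← integrable_indicator_iff measurableSet_closedBall]
  refine h.congr (Eventually.of_forall fun x => ?_)
  simp [indicator]

theorem integrable_of_norm_le_rpow (hN : 1 ≤ N) (hb : b < N) {F : Type*} [NormedAddCommGroup F]
    {f : EuclideanSpace ℝ (Fin N) → F}
    (hf : AEStronglyMeasurable f) {r C : ℝ}
    (h : ∀ x, x ≠ 0 → ‖x‖ ≤ r → ‖f x‖ ≤ C * (1 + ‖x‖ ^ (-b))) (h0 : ∀ x, r < ‖x‖ → f x = 0) :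
    Integrable f := by
  have hi : Integrable ((Metric.closedBall (0 : EuclideanSpace ℝ (Fin N)) r).indicator
      fun x => C * (1 + ‖x‖ ^ (-b))) := by
    rw [integrable_indicator_iff measurableSet_closedBall]
    refine Integrable.const_mul (Integrable.add ?_ (integrableOn_norm_rpow_neg hN hb r)) C
    exact integrableOn_const (measure_closedBall_lt_top.ne)
  refine hi.mono' hf ?_
  filter_upwards [ae_ne_zero hN] with x hx
  by_cases hxr : ‖x‖ ≤ r
  · rw [indicator_of_mem (mem_closedBall_zero_iff.mpr hxr)]
    exact h x hx hxr
  · rw [indicator_of_notMem (by simpa [mem_closedBall_zero_iff] using hxr), h0 x (not_le.mp hxr),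
      norm_zero]

theorem integrable_norm_rpow_schwartz (v : SchwartzMap (EuclideanSpace ℝ (Fin N)) ℂ) {q : ℝ}
    (hq : 0 < q) : Integrable fun x => ‖v x‖ ^ q := by
  have h := (v.memLp (ENNReal.ofReal q) volume).integrable_norm_rpow
    (by simpa using hq) ENNReal.ofReal_ne_top
  rwa [ENNReal.toReal_ofReal hq.le] at h

theorem integrable_norm_sq_schwartz (v : SchwartzMap (EuclideanSpace ℝ (Fin N)) ℂ) :
    Integrable fun x => ‖v x‖ ^ 2 :=
  (v.memLp 2 volume).integrable_norm_pow (by norm_num)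

theorem pd_schwartz (j : Fin N) (v : SchwartzMap (EuclideanSpace ℝ (Fin N)) ℂ) :
    ∃ v' : SchwartzMap (EuclideanSpace ℝ (Fin N)) ℂ, pd j v = v' :=
  ⟨LineDeriv.lineDerivOp (EuclideanSpace.single j (1 : ℝ)) v, by
    ext x
    rw [SchwartzMap.lineDerivOp_apply_eq_fderiv]
    rfl⟩

theorem integrable_gradNormSq (v : SchwartzMap (EuclideanSpace ℝ (Fin N)) ℂ) :
    Integrable (gradNormSq v) := by
  refine integrable_finsetSum _ fun j _ => ?_
  obtain ⟨v', hv'⟩ := pd_schwartz j v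
  exact (integrable_norm_sq_schwartz v').congr (Eventually.of_forall fun x => by
    change _ = ‖pd j v x‖ ^ 2
    rw [hv'])

theorem continuous_norm_rpow_schwartz (v : SchwartzMap (EuclideanSpace ℝ (Fin N)) ℂ) {q : ℝ}
    (hq : 0 < q) : Continuous fun x => ‖v x‖ ^ q :=
  v.continuous.norm.rpow_const fun _ => Or.inr hq.le

theorem integrable_rpow_mul_norm_rpow (hN : 1 ≤ N) (hb0 : 0 < b) (hb : b < N) {q : ℝ} (hq : 0 < q)
    (v : SchwartzMap (EuclideanSpace ℝ (Fin N)) ℂ) :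
    Integrable fun x => ‖x‖ ^ (-b) * ‖v x‖ ^ q := by
  have hm : Measurable fun x : EuclideanSpace ℝ (Fin N) => ‖x‖ ^ (-b) :=
    measurable_norm.pow_const _
  have hm' : AEStronglyMeasurable fun x => ‖x‖ ^ (-b) * ‖v x‖ ^ q :=
    (hm.mul (continuous_norm_rpow_schwartz v hq).measurable).aestronglyMeasurable
  have hv := integrable_norm_rpow_schwartz v hq
  have h1 : Integrable ((Metric.closedBall (0 : EuclideanSpace ℝ (Fin N)) 1).indicator
      fun x => ‖x‖ ^ (-b) * (SchwartzMap.seminorm ℝ 0 0 v) ^ q) := by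
    rw [integrable_indicator_iff measurableSet_closedBall]
    exact (integrableOn_norm_rpow_neg hN hb 1).mul_const _
  refine (h1.add hv).mono' hm' (Eventually.of_forall fun x => ?_)
  have hx0 : 0 ≤ ‖x‖ ^ (-b) := by positivity
  have hv0 : 0 ≤ ‖v x‖ ^ q := by positivity
  have hs0 : (0 : ℝ) ≤ SchwartzMap.seminorm ℝ 0 0 v := apply_nonneg _ _
  rw [Real.norm_of_nonneg (mul_nonneg hx0 hv0), Pi.add_apply]
  by_cases hx : ‖x‖ ≤ 1
  · rw [indicator_of_mem (mem_closedBall_zero_iff.mpr hx)]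
    have : ‖v x‖ ^ q ≤ (SchwartzMap.seminorm ℝ 0 0 v) ^ q :=
      Real.rpow_le_rpow (norm_nonneg _) (SchwartzMap.norm_le_seminorm ℝ v x) hq.le
    have := mul_le_mul_of_nonneg_left this hx0
    linarith
  · rw [indicator_of_notMem (by simpa [mem_closedBall_zero_iff] using hx), zero_add]
    have : ‖x‖ ^ (-b) ≤ 1 := Real.rpow_le_one_of_one_le_of_nonpos (not_le.mp hx).le (by linarith)
    exact mul_le_of_le_one_left hv0 this

end Integrability

section TimeDerivative

variable {N : ℕ} {b p : ℝ} {J : Set ℝ} {t : ℝ}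

/-- The time derivative `i (Δv + |x|^{-b} |v|^{p-1} v)` prescribed by (INLS) for a profile `v`. -/
def inlsVelocity {N : ℕ} (b p : ℝ) (v : EuclideanSpace ℝ (Fin N) → ℂ)
    (x : EuclideanSpace ℝ (Fin N)) : ℂ :=
  Complex.I * (lap v x + ((‖x‖ ^ (-b) * ‖v x‖ ^ (p - 1) : ℝ) : ℂ) * v x)

theorem INLSSolution.hasDerivWithinAt (sol : INLSSolution N b p J) (ht : t ∈ J)
    {x : EuclideanSpace ℝ (Fin N)} (hx : x ≠ 0) :
    HasDerivWithinAt (fun s => sol.u s x) (inlsVelocity b p (sol.u t) x) J t := by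
  obtain ⟨ut', h1, h2⟩ := sol.eqn t ht x hx
  convert h1 using 1
  rw [inlsVelocity]
  linear_combination Complex.I * h2 - ut' * Complex.I_mul_I

theorem norm_lap_schwartz_le (v : SchwartzMap (EuclideanSpace ℝ (Fin N)) ℂ)
    (x : EuclideanSpace ℝ (Fin N)) : ‖lap v x‖ ≤ N * SchwartzMap.seminorm ℝ 0 2 v := by
  have hd : DifferentiableAt ℝ (fderiv ℝ v) x :=
    ((v.smooth 2).fderiv_right (m := 1) (by norm_num)).differentiable (by norm_num) x
  have key : ∀ i, ‖pd i (pd i v) x‖ ≤ SchwartzMap.seminorm ℝ 0 2 v := fun i => by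
    have h1 : pd i (pd i v) x = iteratedFDeriv ℝ 2 v x
        ![EuclideanSpace.single i 1, EuclideanSpace.single i 1] := by
      rw [iteratedFDeriv_two_apply]
      change fderiv ℝ (fun y => fderiv ℝ v y (EuclideanSpace.single i 1)) x _ = _
      rw [fderiv_clm_apply hd (differentiableAt_const _)]
      simp
    rw [h1]
    refine ((iteratedFDeriv ℝ 2 v x).le_opNorm _).trans ?_
    simpa [Fin.prod_univ_two] using SchwartzMap.norm_iteratedFDeriv_le_seminorm ℝ v 2 x
  rw [lap_eq]
  refine (norm_sum_le _ _).trans ((Finset.sum_le_sum fun i _ => key i).trans ?_)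
  simp

theorem norm_pd_schwartz_le (j : Fin N) (v : SchwartzMap (EuclideanSpace ℝ (Fin N)) ℂ)
    (x : EuclideanSpace ℝ (Fin N)) : ‖pd j v x‖ ≤ SchwartzMap.seminorm ℝ 0 1 v := by
  refine (norm_pd_le j v x).trans ?_
  rw [← norm_iteratedFDeriv_one]
  exact SchwartzMap.norm_iteratedFDeriv_le_seminorm ℝ v 1 x

theorem INLSSolution.exists_bound (sol : INLSSolution N b p J) {K : Set ℝ} (hKJ : K ⊆ J)
    (hK : IsCompact K) : ∃ M, 0 ≤ M ∧ ∀ s ∈ K, ∀ x, ‖sol.u s x‖ ≤ M ∧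
      (∀ j, ‖pd j (sol.u s) x‖ ≤ M) ∧ ‖lap (sol.u s) x‖ ≤ M := by
  obtain ⟨A, hA⟩ := sol.seminorm_bound K hKJ hK 0 0
  obtain ⟨B, hB⟩ := sol.seminorm_bound K hKJ hK 0 1
  obtain ⟨C, hC⟩ := sol.seminorm_bound K hKJ hK 0 2
  refine ⟨|A| + |B| + |N * C|, by positivity, fun s hs x => ⟨?_, fun j => ?_, ?_⟩⟩
  · have := (SchwartzMap.norm_le_seminorm ℝ (sol.u s) x).trans (hA s hs)
    linarith [le_abs_self A, abs_nonneg B, abs_nonneg (N * C)]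
  · have := (norm_pd_schwartz_le j (sol.u s) x).trans (hB s hs)
    linarith [le_abs_self B, abs_nonneg A, abs_nonneg (N * C)]
  · have := (norm_lap_schwartz_le (sol.u s) x).trans
      (mul_le_mul_of_nonneg_left (hC s hs) N.cast_nonneg)
    linarith [le_abs_self (N * C), abs_nonneg A, abs_nonneg B]

theorem INLSSolution.exists_velocity_bound (hp : 1 < p) (sol : INLSSolution N b p J) {K : Set ℝ}
    (hKJ : K ⊆ J) (hK : IsCompact K) : ∃ C, 0 ≤ C ∧ ∀ s ∈ K, ∀ x,
      ‖inlsVelocity b p (sol.u s) x‖ ≤ C * (1 + ‖x‖ ^ (-b)) := by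
  obtain ⟨M, hM, h⟩ := sol.exists_bound hKJ hK
  refine ⟨M + M ^ (p - 1) * M, by positivity, fun s hs x => ?_⟩
  obtain ⟨h1, -, h2⟩ := h s hs x
  have hx0 : 0 ≤ ‖x‖ ^ (-b) := by positivity
  have h3 : ‖sol.u s x‖ ^ (p - 1) * ‖sol.u s x‖ ≤ M ^ (p - 1) * M := by gcongr
  have h4 : 0 ≤ M ^ (p - 1) * M := by positivity
  rw [inlsVelocity, norm_mul, Complex.norm_I, one_mul]
  refine (norm_add_le _ _).trans ?_
  rw [norm_mul, Complex.norm_real, Real.norm_of_nonneg (by positivity), mul_assoc]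
  nlinarith [mul_le_mul_of_nonneg_left h3 hx0, mul_nonneg hM hx0]

theorem exists_Icc_mem_nhdsWithin (hJ : J.OrdConnected) (ht : t ∈ J) :
    ∃ a c, Icc a c ⊆ J ∧ t ∈ Icc a c ∧ Icc a c ∈ 𝓝[J] t := by
  have h1 : ∃ a ∈ J, a ≤ t ∧ ∀ᶠ s in 𝓝[J] t, a ≤ s := by
    by_cases h : ∃ a ∈ J, a < t
    · obtain ⟨a, ha, hat⟩ := h
      exact ⟨a, ha, hat.le, nhdsWithin_le_nhds (Ici_mem_nhds hat)⟩
    · push Not at h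
      exact ⟨t, ht, le_rfl, eventually_mem_nhdsWithin.mono fun s hs => h s hs⟩
  have h2 : ∃ c ∈ J, t ≤ c ∧ ∀ᶠ s in 𝓝[J] t, s ≤ c := by
    by_cases h : ∃ c ∈ J, t < c
    · obtain ⟨c, hc, htc⟩ := h
      exact ⟨c, hc, htc.le, nhdsWithin_le_nhds (Iic_mem_nhds htc)⟩
    · push Not at h
      exact ⟨t, ht, le_rfl, eventually_mem_nhdsWithin.mono fun s hs => h s hs⟩
  obtain ⟨a, ha, hat, ha'⟩ := h1
  obtain ⟨c, hc, htc, hc'⟩ := h2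
  exact ⟨a, c, hJ.out ha hc, ⟨hat, htc⟩, ha'.and hc'⟩

theorem INLSSolution.continuousOn_pd (hJ : J.OrdConnected) (sol : INLSSolution N b p J)
    (j : Fin N) {x : EuclideanSpace ℝ (Fin N)} (hx : x ≠ 0) :
    ContinuousOn (fun s => pd j (sol.u s) x) J := by
  by_cases hsub : J.Subsingleton
  · exact hsub.continuousOn _
  rw [not_subsingleton_iff] at hsub
  obtain ⟨a, ha, c, hc, hac⟩ := hsub.exists_lt
  have hint : (interior J).Nonempty :=
    ((nonempty_Ioo.mpr hac)).mono
      (interior_maximal (Ioo_subset_Icc_self.trans (hJ.out ha hc)) isOpen_Ioo)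
  have hopen : IsOpen {x : EuclideanSpace ℝ (Fin N) | x ≠ 0} := isOpen_ne
  have hu : UniqueDiffOn ℝ (J ×ˢ {x : EuclideanSpace ℝ (Fin N) | x ≠ 0}) :=
    (uniqueDiffOn_convex hJ.convex hint).prod hopen.uniqueDiffOn
  have hcont := sol.smooth.continuousOn_fderivWithin hu (by norm_num)
  have hcont' : ContinuousOn (fun s : ℝ => fderivWithin ℝ
      (fun q : ℝ × EuclideanSpace ℝ (Fin N) => sol.u q.1 q.2)
      (J ×ˢ {x : EuclideanSpace ℝ (Fin N) | x ≠ 0}) (s, x) (0, EuclideanSpace.single j 1)) J :=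
    (hcont.comp (f := fun s : ℝ => (s, x)) (by fun_prop) fun s hs => ⟨hs, hx⟩).clm_apply
      continuousOn_const
  refine hcont'.congr fun s hs => ?_
  have hd := ((sol.smooth.differentiableOn (by norm_num)) (s, x) ⟨hs, hx⟩).hasFDerivWithinAt
  have hg : HasFDerivWithinAt (fun y : EuclideanSpace ℝ (Fin N) => (s, y))
      (ContinuousLinearMap.inr ℝ ℝ (EuclideanSpace ℝ (Fin N))) {x | x ≠ 0} x :=
    (hasFDerivAt_prodMk_right s x).hasFDerivWithinAt
  have h := (hd.comp x hg fun y hy => ⟨hs, hy⟩).hasFDerivAt (hopen.mem_nhds hx)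
  change fderiv ℝ (fun y => sol.u s y) x _ = _
  rw [HasFDerivAt.fderiv (f := fun y => sol.u s y) h]
  simp

end TimeDerivative

section Virial

variable {N : ℕ} {b p : ℝ} {J : Set ℝ} {t : ℝ}

theorem INLSSolution.tendsto_integral_inner_slope (hN : 1 ≤ N) (hb : b < N) (hp : 1 < p)
    (hJ : J.OrdConnected) (sol : INLSSolution N b p J) (ht : t ∈ J) (c : ℂ)
    {Z : ℝ → EuclideanSpace ℝ (Fin N) → ℂ} {Z₀ : EuclideanSpace ℝ (Fin N) → ℂ} {r B : ℝ}
    (hZc : ∀ s, Continuous (Z s)) (hZb : ∀ᶠ s in 𝓝[J] t, ∀ x, ‖Z s x‖ ≤ B)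
    (hZs : ∀ s x, r < ‖x‖ → Z s x = 0)
    (hZt : ∀ x, x ≠ 0 → Tendsto (fun s => Z s x) (𝓝[J] t) (𝓝 (Z₀ x))) :
    Tendsto (fun s => ∫ x, inner ℝ (c * ((s - t)⁻¹ • (sol.u s x - sol.u t x))) (Z s x))
      (𝓝[J \ {t}] t) (𝓝 (∫ x, inner ℝ (c * inlsVelocity b p (sol.u t) x) (Z₀ x))) := by
  obtain ⟨a, d, hK, htK, hKn⟩ := exists_Icc_mem_nhdsWithin hJ ht
  obtain ⟨C, hC, hv⟩ := sol.exists_velocity_bound hp hK isCompact_Icc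
  have hB : 0 ≤ B := by
    have := mem_closure_iff_nhdsWithin_neBot.mp (subset_closure ht)
    obtain ⟨s, hs⟩ := hZb.exists
    exact (norm_nonneg _).trans (hs 0)
  have hle : 𝓝[J \ {t}] t ≤ 𝓝[J] t := nhdsWithin_mono _ sdiff_subset
  have hbound : Integrable fun x : EuclideanSpace ℝ (Fin N) =>
      (Metric.closedBall (0 : EuclideanSpace ℝ (Fin N)) r).indicator
        (fun x => ‖c‖ * (C * (1 + ‖x‖ ^ (-b))) * B) x := by
    rw [integrable_indicator_iff measurableSet_closedBall]
    refine (Integrable.const_mul (Integrable.const_mul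
      (Integrable.add ?_ (integrableOn_norm_rpow_neg hN hb r)) C) _).mul_const _
    exact integrableOn_const (measure_closedBall_lt_top.ne)
  refine tendsto_integral_filter_of_dominated_convergence _ ?_ ?_ hbound ?_
  · refine Eventually.of_forall fun s => Continuous.aestronglyMeasurable ?_
    have h1 : Continuous fun x => sol.u s x - sol.u t x :=
      (sol.u s).continuous.sub (sol.u t).continuous
    have h2 : Continuous fun x => (s - t)⁻¹ • (sol.u s x - sol.u t x) :=
      h1.const_smul (s - t)⁻¹
    exact Continuous.inner (continuous_const.mul h2) (hZc s)
  · filter_upwards [hle hKn, hle hZb, eventually_mem_nhdsWithin] with s hsK hsB hsJ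
    filter_upwards [ae_ne_zero hN] with x hx
    by_cases hxr : ‖x‖ ≤ r
    · rw [indicator_of_mem (mem_closedBall_zero_iff.mpr hxr)]
      refine (norm_inner_le_norm _ _).trans ?_
      have h1 : ‖sol.u s x - sol.u t x‖ ≤ C * (1 + ‖x‖ ^ (-b)) * ‖s - t‖ :=
        (convex_Icc a d).norm_image_sub_le_of_norm_hasDerivWithin_le (f := fun s => sol.u s x)
          (fun y hy => (sol.hasDerivWithinAt (hK hy) hx).mono hK) (fun y hy => hv y hy x) htK hsK
      have hst : 0 < ‖s - t‖ := norm_pos_iff.mpr (sub_ne_zero.mpr hsJ.2)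
      have h2 : ‖(s - t)⁻¹ • (sol.u s x - sol.u t x)‖ ≤ C * (1 + ‖x‖ ^ (-b)) := by
        rw [norm_smul, norm_inv, inv_mul_le_iff₀ hst, mul_comm]
        exact h1
      rw [norm_mul]
      gcongr
      exact hsB x
    · rw [hZs s x (not_le.mp hxr), inner_zero_right, norm_zero]
      exact indicator_nonneg (fun _ _ => by positivity) _
  · filter_upwards [ae_ne_zero hN] with x hx
    have h1 := hasDerivWithinAt_iff_tendsto_slope.mp (sol.hasDerivWithinAt ht hx)
    exact Tendsto.inner (tendsto_const_nhds.mul h1) ((hZt x hx).mono_left hle)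

theorem INLSSolution.hasDerivWithinAt_of_sub_eq (hN : 1 ≤ N) (hb : b < N) (hp : 1 < p)
    (hJ : J.OrdConnected) (sol : INLSSolution N b p J) (ht : t ∈ J) (c : ℂ) {f : ℝ → ℝ}
    {Z : ℝ → EuclideanSpace ℝ (Fin N) → ℂ} {Z₀ : EuclideanSpace ℝ (Fin N) → ℂ} {r B : ℝ}
    (hf : ∀ s, f s - f t = ∫ x, inner ℝ (c * (sol.u s x - sol.u t x)) (Z s x))
    (hZc : ∀ s, Continuous (Z s)) (hZb : ∀ᶠ s in 𝓝[J] t, ∀ x, ‖Z s x‖ ≤ B)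
    (hZs : ∀ s x, r < ‖x‖ → Z s x = 0)
    (hZt : ∀ x, x ≠ 0 → Tendsto (fun s => Z s x) (𝓝[J] t) (𝓝 (Z₀ x))) :
    HasDerivWithinAt f (∫ x, inner ℝ (c * inlsVelocity b p (sol.u t) x) (Z₀ x)) J t := by
  rw [hasDerivWithinAt_iff_tendsto_slope]
  refine (sol.tendsto_integral_inner_slope hN hb hp hJ ht c hZc hZb hZs hZt).congr fun s => ?_
  rw [slope_def_module, hf, smul_eq_mul, ← integral_const_mul]
  refine integral_congr_ae (Eventually.of_forall fun x => ?_)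
  simp only [mul_smul_comm, real_inner_smul_left]

variable {φ : EuclideanSpace ℝ (Fin N) → ℝ}

theorem exists_norm_le_of_hasCompactSupport {F : Type*} [NormedAddCommGroup F]
    {f : EuclideanSpace ℝ (Fin N) → F} (hf : Continuous f) (hs : HasCompactSupport f) :
    ∃ A, 0 ≤ A ∧ ∀ x, ‖f x‖ ≤ A := by
  obtain ⟨A, hA⟩ := hs.exists_bound_of_continuous hf
  exact ⟨|A|, abs_nonneg A, fun x => (hA x).trans (le_abs_self A)⟩

theorem exists_forall_lt_norm_eq_zero {F : Type*} [NormedAddCommGroup F]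
    {f : EuclideanSpace ℝ (Fin N) → F} (hs : HasCompactSupport f) :
    ∃ r, ∀ x, r < ‖x‖ → f =ᶠ[𝓝 x] 0 := by
  obtain ⟨r, hr⟩ := (hs : IsCompact (tsupport f)).isBounded.subset_closedBall 0
  refine ⟨r, fun x hx => notMem_tsupport_iff_eventuallyEq.mp fun h => ?_⟩
  have := mem_closedBall_zero_iff.mp (hr h)
  linarith

theorem INLSSolution.tendsto_apply (sol : INLSSolution N b p J) (ht : t ∈ J)
    (x : EuclideanSpace ℝ (Fin N)) :
    Tendsto (fun s => sol.u s x) (𝓝[J] t) (𝓝 (sol.u t x)) :=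
  (sol.cont.comp (f := fun s : ℝ => (s, x)) (by fun_prop) fun s hs => ⟨hs, mem_univ _⟩) t ht

/-- The localized momentum `∫ ∑ⱼ ∂ⱼφ Re(i ∂ⱼv · conj v)`. -/
def momentum {N : ℕ} (φ : EuclideanSpace ℝ (Fin N) → ℝ) (v : EuclideanSpace ℝ (Fin N) → ℂ) : ℝ :=
  ∫ x, ∑ j, pd j φ x * inner ℝ (Complex.I * pd j v x) (v x)

theorem INLSSolution.hasDerivWithinAt_integral_mul_norm_sq (hN : 1 ≤ N) (hb : b < N) (hp : 1 < p)
    (hJ : J.OrdConnected) (sol : INLSSolution N b p J) (ht : t ∈ J)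
    (hφ : ContDiff ℝ 4 φ) (hs : HasCompactSupport φ) :
    HasDerivWithinAt (fun s => ∫ x, φ x * ‖sol.u s x‖ ^ 2) (-2 * momentum φ (sol.u t)) J t := by
  obtain ⟨A, hA0, hA⟩ := exists_norm_le_of_hasCompactSupport hφ.continuous hs
  obtain ⟨r, hr⟩ := exists_forall_lt_norm_eq_zero hs
  obtain ⟨a, d, hK, htK, hKn⟩ := exists_Icc_mem_nhdsWithin hJ ht
  obtain ⟨M, hM, hu⟩ := sol.exists_bound hK isCompact_Icc
  have hint : ∀ s, Integrable fun x => φ x * ‖sol.u s x‖ ^ 2 := fun s =>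
    (hφ.continuous.mul ((sol.u s).continuous.norm.pow 2)).integrable_of_hasCompactSupport
      hs.mul_right
  have h := sol.hasDerivWithinAt_of_sub_eq hN hb hp hJ ht 1
    (f := fun s => ∫ x, φ x * ‖sol.u s x‖ ^ 2) (Z := fun s x => φ x • (sol.u s x + sol.u t x))
    (Z₀ := fun x => φ x • (sol.u t x + sol.u t x)) (r := r) (B := A * (M + M)) ?_ ?_ ?_ ?_ ?_
  · convert h using 1
    rw [momentum, neg_mul, ← mul_neg, ← integral_neg,
      ← integral_mul_inner_I_lap hφ hs ((sol.u t).smooth 4), ← integral_const_mul]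
    refine integral_congr_ae (Eventually.of_forall fun x => ?_)
    simp only [inlsVelocity, one_mul, inner_smul_right, inner_add_right, mul_add, inner_add_left]
    rw [mul_left_comm Complex.I, ← Complex.real_smul, inner_smul_left, inner_I_mul_self]
    simp
    ring
  · intro s
    rw [← integral_sub (hint s) (hint t)]
    refine integral_congr_ae (Eventually.of_forall fun x => ?_)
    simp only [one_mul, inner_smul_right, inner_add_right, inner_sub_left,
      real_inner_self_eq_norm_sq, real_inner_comm (sol.u s x) (sol.u t x)]
    ring
  · exact fun s => hφ.continuous.smul ((sol.u s).continuous.add (sol.u t).continuous)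
  · filter_upwards [hKn] with s hsK x
    rw [norm_smul]
    exact mul_le_mul (hA x) ((norm_add_le _ _).trans (add_le_add (hu s hsK x).1 (hu t htK x).1))
      (norm_nonneg _) hA0
  · intro s x hx
    simp [(hr x hx).eq_of_nhds]
  · intro x hx
    exact ((sol.tendsto_apply ht x).add_const _).const_smul _

theorem INLSSolution.hasDerivWithinAt_momentum (hN : 1 ≤ N) (hb : b < N) (hp : 1 < p)
    (hJ : J.OrdConnected) (sol : INLSSolution N b p J) (ht : t ∈ J)
    (hφ : ContDiff ℝ 4 φ) (hs : HasCompactSupport φ) :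
    HasDerivWithinAt (fun s => momentum φ (sol.u s))
      (∫ x, inner ℝ (lap (sol.u t) x +
          ((‖x‖ ^ (-b) * ‖sol.u t x‖ ^ (p - 1) : ℝ) : ℂ) * sol.u t x)
        (lapR φ x • sol.u t x + ∑ j, pd j φ x • (pd j (sol.u t) x + pd j (sol.u t) x))) J t := by
  have hφ1 : ∀ j, ContDiff ℝ 3 (pd j φ) := fun j => contDiff_pd j hφ (by norm_num)
  have hpd : ∀ s j, Continuous (pd j (sol.u s)) := fun s j =>
    (contDiff_pd (m := 0) j ((sol.u s).smooth 1) (by norm_num)).continuous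
  obtain ⟨A, hA0, hA⟩ := exists_norm_le_of_hasCompactSupport (contDiff_lapR hφ).continuous
    (hasCompactSupport_lapR hs)
  choose B hB0 hB using fun j => exists_norm_le_of_hasCompactSupport (hφ1 j).continuous
    (hasCompactSupport_pd j hs)
  obtain ⟨r, hr⟩ := exists_forall_lt_norm_eq_zero (hasCompactSupport_lapR hs)
  choose r' hr' using fun j => exists_forall_lt_norm_eq_zero (hasCompactSupport_pd j hs)
  obtain ⟨a, d, hK, htK, hKn⟩ := exists_Icc_mem_nhdsWithin hJ ht
  obtain ⟨M, hM, hu⟩ := sol.exists_bound hK isCompact_Icc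
  have h := sol.hasDerivWithinAt_of_sub_eq hN hb hp hJ ht (-Complex.I)
    (f := fun s => momentum φ (sol.u s))
    (Z := fun s x => lapR φ x • sol.u s x + ∑ j, pd j φ x • (pd j (sol.u s) x + pd j (sol.u t) x))
    (Z₀ := fun x => lapR φ x • sol.u t x +
      ∑ j, pd j φ x • (pd j (sol.u t) x + pd j (sol.u t) x))
    (r := |r| + ∑ j, |r' j|) (B := A * M + ∑ j, B j * (M + M)) ?_ ?_ ?_ ?_ ?_
  · convert h using 1
    refine integral_congr_ae (Eventually.of_forall fun x => ?_)
    simp only [inlsVelocity]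
    rw [← mul_assoc, neg_mul, Complex.I_mul_I, neg_neg, one_mul]
  · intro s
    rw [momentum, momentum, integral_momentum_sub hφ hs ((sol.u s).smooth 4) ((sol.u t).smooth 4)]
    simp only [neg_mul, inner_neg_left]
  · intro s
    exact ((contDiff_lapR hφ).continuous.smul (sol.u s).continuous).add
      (continuous_finsetSum _ fun j _ => (hφ1 j).continuous.smul ((hpd s j).add (hpd t j)))
  · filter_upwards [hKn] with s hsK x
    refine (norm_add_le _ _).trans (add_le_add ?_ ((norm_sum_le _ _).trans
      (Finset.sum_le_sum fun j _ => ?_)))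
    · rw [norm_smul]
      exact mul_le_mul (hA x) (hu s hsK x).1 (norm_nonneg _) hA0
    · rw [norm_smul]
      exact mul_le_mul (hB j x) ((norm_add_le _ _).trans
        (add_le_add ((hu s hsK x).2.1 j) ((hu t htK x).2.1 j))) (norm_nonneg _) (hB0 j)
  · intro s x hx
    have hsum : 0 ≤ ∑ j, |r' j| := Finset.sum_nonneg fun j _ => abs_nonneg _
    have h1 : lapR φ x = 0 := (hr x (by linarith [le_abs_self r])).eq_of_nhds
    have h2 : ∀ j, pd j φ x = 0 := fun j => (hr' j x (by
      have := Finset.single_le_sum (f := fun j => |r' j|) (fun i _ => abs_nonneg _)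
        (Finset.mem_univ j)
      linarith [le_abs_self (r' j), abs_nonneg r])).eq_of_nhds
    simp [h1, h2]
  · intro x hx
    exact ((sol.tendsto_apply ht x).const_smul _).add (tendsto_finsetSum _ fun j _ =>
      ((show Tendsto (fun s => pd j (sol.u s) x) _ _ from
        sol.continuousOn_pd hJ j hx t ht).add_const _).const_smul _)

end Virial

section Nonlinear

variable {N : ℕ} {b p : ℝ}

theorem integrable_rpow_neg_mul (hN : 1 ≤ N) (hb : b < N) {k : EuclideanSpace ℝ (Fin N) → ℝ}
    (hk : Continuous k) (hs : HasCompactSupport k) :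
    Integrable fun x : EuclideanSpace ℝ (Fin N) => ‖x‖ ^ (-b) * k x := by
  obtain ⟨A, hA0, hA⟩ := exists_norm_le_of_hasCompactSupport hk hs
  obtain ⟨r, hr⟩ := exists_forall_lt_norm_eq_zero hs
  have hm : Measurable fun x : EuclideanSpace ℝ (Fin N) => ‖x‖ ^ (-b) :=
    measurable_norm.pow_const _
  refine integrable_of_norm_le_rpow hN hb (hm.mul hk.measurable).aestronglyMeasurable (r := r)
    (C := A) (fun x _ _ => ?_) fun x hx => by simp [(hr x hx).eq_of_nhds]
  have hx : 0 ≤ ‖x‖ ^ (-b) := by positivity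
  rw [norm_mul, Real.norm_of_nonneg hx]
  nlinarith [mul_le_mul_of_nonneg_left (hA x) hx]

theorem cutoff_deriv_eq_zero {w : ℝ → ℝ} {R r : ℝ} (h : ∀ r, 2 * R ≤ r → w r = 0)
    (hr : 2 * R < r) : deriv w r = 0 := by
  have : w =ᶠ[𝓝 r] fun _ => 0 := (eventually_gt_nhds hr).mono fun s hs => h s hs.le
  rw [this.deriv_eq, deriv_const]

theorem hasDerivAt_sq_add_rpow {ε : ℝ} (hε : 0 < ε) (b r : ℝ) :
    HasDerivAt (fun r : ℝ => (r ^ 2 + ε) ^ (-b / 2)) (-b * r * (r ^ 2 + ε) ^ (-b / 2 - 1)) r := by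
  have h : HasDerivAt (fun r : ℝ => r ^ 2 + ε) (2 * r) r := by
    simpa using (hasDerivAt_pow 2 r).add_const ε
  convert h.rpow_const (p := -b / 2) (Or.inl (by positivity)) using 1
  ring

theorem sq_add_rpow_le {r ε : ℝ} (hr : 0 < r) (hε : 0 < ε) (hb : 0 < b) :
    (r ^ 2 + ε) ^ (-b / 2) ≤ r ^ (-b) := by
  have h : r ^ (-b) = (r ^ 2) ^ (-b / 2) := by
    rw [← Real.rpow_natCast, ← Real.rpow_mul hr.le]
    congr 1
    push_cast
    ring
  rw [h]
  exact Real.rpow_le_rpow_of_nonpos (by positivity) (by linarith) (by linarith)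

theorem tendsto_sq_add_rpow {r : ℝ} (hr : 0 < r) (q : ℝ) :
    Tendsto (fun ε : ℝ => (r ^ 2 + ε) ^ q) (𝓝[>] 0) (𝓝 (r ^ (2 * q))) := by
  have h : r ^ (2 * q) = (r ^ 2 + 0) ^ q := by
    rw [add_zero, ← Real.rpow_natCast, ← Real.rpow_mul hr.le]
    norm_num
  rw [h]
  refine (Tendsto.rpow_const (tendsto_const_nhds.add tendsto_id) (Or.inl ?_)).mono_left
    nhdsWithin_le_nhds
  positivity

theorem abs_mul_sq_add_rpow_le {r ε d C : ℝ} (hr : 0 < r) (hε : 0 < ε) (hb : 0 < b)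
    (hC : 0 ≤ C) (hd : |d| ≤ C * r) :
    |d * (-b * r * (r ^ 2 + ε) ^ (-b / 2 - 1))| ≤ C * b * r ^ (-b) := by
  have hpos : 0 < r ^ 2 + ε := by positivity
  have h1 : (r ^ 2 + ε) ^ (-b / 2 - 1) * (r ^ 2 + ε) = (r ^ 2 + ε) ^ (-b / 2) := by
    rw [Real.rpow_sub_one hpos.ne', div_mul_cancel₀ _ hpos.ne']
  have h2 : 0 ≤ (r ^ 2 + ε) ^ (-b / 2 - 1) := by positivity
  calc |d * (-b * r * (r ^ 2 + ε) ^ (-b / 2 - 1))|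
      = |d| * (b * r * (r ^ 2 + ε) ^ (-b / 2 - 1)) := by
        rw [abs_mul, abs_mul, abs_mul, abs_neg, abs_of_pos hb, abs_of_pos hr, abs_of_nonneg h2]
    _ ≤ C * r * (b * r * (r ^ 2 + ε) ^ (-b / 2 - 1)) := by gcongr
    _ = C * b * ((r ^ 2 + ε) ^ (-b / 2 - 1) * r ^ 2) := by ring
    _ ≤ C * b * ((r ^ 2 + ε) ^ (-b / 2 - 1) * (r ^ 2 + ε)) := by gcongr; linarith
    _ = C * b * (r ^ 2 + ε) ^ (-b / 2) := by rw [h1]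
    _ ≤ C * b * r ^ (-b) := by gcongr; exact sq_add_rpow_le hr hε hb

variable {w : ℝ → ℝ} {R C : ℝ}

theorem sum_pd_comp_norm_mul_pd_comp_norm {f g : ℝ → ℝ} {f' g' : ℝ}
    {x : EuclideanSpace ℝ (Fin N)} (hx : x ≠ 0) (hf : HasDerivAt f f' ‖x‖)
    (hg : HasDerivAt g g' ‖x‖) :
    ∑ j, pd j (fun y : EuclideanSpace ℝ (Fin N) => f ‖y‖) x *
      pd j (fun y : EuclideanSpace ℝ (Fin N) => g ‖y‖) x = f' * g' := by
  have h0 : ‖x‖ ≠ 0 := norm_ne_zero_iff.mpr hx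
  have h1 : ∀ j, pd j (fun y : EuclideanSpace ℝ (Fin N) => f ‖y‖) x *
      pd j (fun y : EuclideanSpace ℝ (Fin N) => g ‖y‖) x =
      f' / ‖x‖ * (g' / ‖x‖) * x j ^ 2 := fun j => by
    rw [pd_comp_norm j hx hf, pd_comp_norm j hx hg]
    ring
  rw [Finset.sum_congr rfl fun j _ => h1 j, ← Finset.mul_sum, ← EuclideanSpace.real_norm_sq_eq]
  field_simp

theorem integral_rpow_neg_mul_sum_pd (hN : 1 ≤ N) (hb0 : 0 < b) (hb : b < N) (hC : 0 ≤ C)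
    (hw : ContDiff ℝ 4 w) (hw0 : ∀ r, 2 * R ≤ r → w r = 0)
    (hw1 : ∀ r, 0 ≤ r → |deriv w r| ≤ C * r)
    (hφ : ContDiff ℝ 4 fun x : EuclideanSpace ℝ (Fin N) => w ‖x‖)
    {g : EuclideanSpace ℝ (Fin N) → ℝ} (hg : ContDiff ℝ 1 g) {G : ℝ} (hG : ∀ x, |g x| ≤ G) :
    ∫ x : EuclideanSpace ℝ (Fin N), ‖x‖ ^ (-b) *
        ∑ j, pd j (fun x : EuclideanSpace ℝ (Fin N) => w ‖x‖) x * pd j g x =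
      ∫ x, -(g x * (‖x‖ ^ (-b) * lapR (fun x : EuclideanSpace ℝ (Fin N) => w ‖x‖) x
        - b * ‖x‖ ^ (-b) * (deriv w ‖x‖ / ‖x‖))) := by
  set φ := fun x : EuclideanSpace ℝ (Fin N) => w ‖x‖ with hφdef
  have hs : HasCompactSupport φ := hasCompactSupport_cutoff hw0
  have hφ1 : ∀ j, ContDiff ℝ 3 (pd j φ) := fun j => contDiff_pd j hφ (by norm_num)
  have hpdg : ∀ j, Continuous (pd j g) := fun j =>
    (contDiff_pd (m := 0) j hg (by norm_num)).continuous
  have hkc : Continuous fun x => ∑ j, pd j φ x * pd j g x :=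
    continuous_finsetSum _ fun j _ => (hφ1 j).continuous.mul (hpdg j)
  have hks : HasCompactSupport fun x => ∑ j, pd j φ x * pd j g x :=
    hasCompactSupport_sum _ fun j _ => (hasCompactSupport_pd j hs).mul_right
  have hρ : ∀ ε : ℝ, 0 < ε →
      ContDiff ℝ 1 fun x : EuclideanSpace ℝ (Fin N) => (‖x‖ ^ 2 + ε) ^ (-b / 2) := fun ε hε =>
    ((contDiff_norm_sq ℝ).add contDiff_const).rpow_const_of_ne fun x => by positivity
  have hwd : ∀ r, HasDerivAt w (deriv w r) r := fun r =>
    (hw.differentiable (by norm_num) r).hasDerivAt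
  have hpos : ∀ᶠ ε : ℝ in 𝓝[>] 0, 0 < ε := eventually_mem_nhdsWithin
  obtain ⟨A, hA0, hA⟩ := exists_norm_le_of_hasCompactSupport (contDiff_lapR hφ).continuous
    (hasCompactSupport_lapR hs)
  have hG0 : 0 ≤ G := (abs_nonneg _).trans (hG 0)
  have hlap : ∀ x : EuclideanSpace ℝ (Fin N), 2 * R < ‖x‖ → lapR φ x = 0 := by
    intro x hx
    have h0 : φ =ᶠ[𝓝 x] fun _ => 0 :=
      ((continuous_norm.tendsto x).eventually (eventually_gt_nhds hx)).mono
        fun y hy => hw0 _ (le_of_lt hy)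
    have h1 : ∀ j, pd j φ =ᶠ[𝓝 x] fun _ => 0 := fun j => by
      filter_upwards [h0.eventuallyEq_nhds] with y hy
      simp [pd, hy.fderiv_eq]
    refine Finset.sum_eq_zero fun j _ => ?_
    change fderiv ℝ (pd j φ) x _ = 0
    simp [(h1 j).fderiv_eq]
  have hL : Tendsto (fun ε : ℝ => ∫ x : EuclideanSpace ℝ (Fin N), (‖x‖ ^ 2 + ε) ^ (-b / 2) *
      ∑ j, pd j φ x * pd j g x) (𝓝[>] 0) (𝓝 (∫ x : EuclideanSpace ℝ (Fin N), ‖x‖ ^ (-b) *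
        ∑ j, pd j φ x * pd j g x)) := by
    refine tendsto_integral_filter_of_dominated_convergence _ ?_ ?_
      (integrable_rpow_neg_mul hN hb hkc hks).norm ?_
    · filter_upwards [hpos] with ε hε
      exact ((hρ ε hε).continuous.mul hkc).aestronglyMeasurable
    · filter_upwards [hpos] with ε hε
      filter_upwards [ae_ne_zero hN] with x hx
      rw [norm_mul, norm_mul]
      refine mul_le_mul_of_nonneg_right ?_ (norm_nonneg _)
      refine le_trans (le_of_eq (Real.norm_of_nonneg (by positivity))) ?_
      exact (sq_add_rpow_le (norm_pos_iff.mpr hx) hε hb0).trans (Real.le_norm_self _)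
    · filter_upwards [ae_ne_zero hN] with x hx
      have := tendsto_sq_add_rpow (norm_pos_iff.mpr hx) (-b / 2)
      rw [mul_div_cancel₀ _ two_ne_zero] at this
      exact this.mul_const _
  have hRt : Tendsto (fun ε : ℝ => ∫ x : EuclideanSpace ℝ (Fin N),
      -(g x * ((‖x‖ ^ 2 + ε) ^ (-b / 2) * lapR φ x + ∑ j, pd j φ x *
        pd j (fun x : EuclideanSpace ℝ (Fin N) => (‖x‖ ^ 2 + ε) ^ (-b / 2)) x))) (𝓝[>] 0)
      (𝓝 (∫ x, -(g x * (‖x‖ ^ (-b) * lapR φ x - b * ‖x‖ ^ (-b) * (deriv w ‖x‖ / ‖x‖))))) := by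
    have hsum : ∀ ε : ℝ, 0 < ε → ∀ x : EuclideanSpace ℝ (Fin N), x ≠ 0 →
        ∑ j, pd j φ x * pd j (fun x : EuclideanSpace ℝ (Fin N) => (‖x‖ ^ 2 + ε) ^ (-b / 2)) x =
          deriv w ‖x‖ * (-b * ‖x‖ * (‖x‖ ^ 2 + ε) ^ (-b / 2 - 1)) := fun ε hε x hx =>
      sum_pd_comp_norm_mul_pd_comp_norm hx (hwd _) (hasDerivAt_sq_add_rpow hε b ‖x‖)
    have hbound : Integrable fun x : EuclideanSpace ℝ (Fin N) =>
        (Metric.closedBall (0 : EuclideanSpace ℝ (Fin N)) (2 * R)).indicator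
          (fun x => ‖x‖ ^ (-b) * (G * (A + C * b))) x := by
      rw [integrable_indicator_iff measurableSet_closedBall]
      exact (integrableOn_norm_rpow_neg hN hb _).mul_const _
    refine tendsto_integral_filter_of_dominated_convergence _ ?_ ?_ hbound ?_
    · filter_upwards [hpos] with ε hε
      exact (hg.continuous.mul (((hρ ε hε).continuous.mul (contDiff_lapR hφ).continuous).add
        (continuous_finsetSum _ fun j _ => (hφ1 j).continuous.mul
          (contDiff_pd (m := 0) j (hρ ε hε) (by norm_num)).continuous))).neg.aestronglyMeasurable
    · filter_upwards [hpos] with ε hε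
      filter_upwards [ae_ne_zero hN] with x hx
      have hx0 := norm_pos_iff.mpr hx
      rw [hsum ε hε x hx]
      by_cases hxr : ‖x‖ ≤ 2 * R
      · rw [indicator_of_mem (mem_closedBall_zero_iff.mpr hxr), norm_neg, norm_mul,
          mul_left_comm (‖x‖ ^ (-b))]
        have h1 : ‖(‖x‖ ^ 2 + ε) ^ (-b / 2) * lapR φ x‖ ≤ ‖x‖ ^ (-b) * A := by
          rw [norm_mul, Real.norm_of_nonneg (by positivity)]
          exact mul_le_mul (sq_add_rpow_le hx0 hε hb0) (hA x) (norm_nonneg _) (by positivity)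
        have h2 := abs_mul_sq_add_rpow_le hx0 hε hb0 hC (hw1 _ hx0.le)
        refine mul_le_mul (hG x) ((norm_add_le _ _).trans ?_) (norm_nonneg _) hG0
        rw [← Real.norm_eq_abs] at h2
        linarith
      · rw [hlap x (not_le.mp hxr), cutoff_deriv_eq_zero hw0 (not_le.mp hxr)]
        simp only [mul_zero, zero_mul, add_zero, neg_zero, norm_zero]
        exact indicator_nonneg (fun _ _ => by positivity) _
    · filter_upwards [ae_ne_zero hN] with x hx
      have hx0 := norm_pos_iff.mpr hx
      have h1 := tendsto_sq_add_rpow hx0 (-b / 2)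
      have h2 := tendsto_sq_add_rpow hx0 (-b / 2 - 1)
      rw [mul_div_cancel₀ _ two_ne_zero] at h1
      have h3 : ‖x‖ ^ (2 * (-b / 2 - 1)) = ‖x‖ ^ (-b) / ‖x‖ ^ 2 := by
        rw [← Real.rpow_natCast, ← Real.rpow_sub hx0]
        congr 1
        push_cast
        ring
      have h4 : -(g x * (‖x‖ ^ (-b) * lapR φ x - b * ‖x‖ ^ (-b) * (deriv w ‖x‖ / ‖x‖))) =
          -(g x * (‖x‖ ^ (-b) * lapR φ x +
            deriv w ‖x‖ * (-b * ‖x‖ * ‖x‖ ^ (2 * (-b / 2 - 1))))) := by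
        rw [h3]
        field_simp
        ring
      rw [h4]
      refine Tendsto.congr' ?_ (((h1.mul_const _).add
        ((h2.const_mul _).const_mul _)).const_mul _).neg
      filter_upwards [hpos] with ε hε
      rw [hsum ε hε x hx]
  refine tendsto_nhds_unique hL (hRt.congr' ?_)
  filter_upwards [hpos] with ε hε
  exact (integral_weight_mul_pd hφ hs (hρ ε hε) hg).symm

theorem pd_norm_rpow_add_one (hp : 1 < p) {v : EuclideanSpace ℝ (Fin N) → ℂ}
    (hv : ContDiff ℝ 1 v) (j : Fin N) (x : EuclideanSpace ℝ (Fin N)) :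
    pd j (fun x => ‖v x‖ ^ (p + 1)) x =
      (p + 1) * (‖v x‖ ^ (p - 1) * inner ℝ (v x) (pd j v x)) := by
  rw [pd, (hv.differentiable (by norm_num)).fderiv_norm_rpow (by linarith)]
  simp only [smul_apply, ContinuousLinearMap.comp_apply, innerSL_apply_apply,
    smul_eq_mul, pd]
  rw [show p + 1 - 2 = p - 1 by ring, mul_assoc]

theorem rpow_sub_one_mul_sq (hp : 1 < p) {r : ℝ} (hr : 0 ≤ r) :
    r ^ (p - 1) * r ^ 2 = r ^ (p + 1) := by
  rw [← Real.rpow_natCast, ← Real.rpow_add_of_nonneg hr (by linarith) (by norm_num)]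
  norm_num
  ring_nf

theorem integral_inner_nonlinearity_dilation (hN : 1 ≤ N) (hb0 : 0 < b) (hb : b < N) (hp : 1 < p)
    (hC : 0 ≤ C) (hw : ContDiff ℝ 4 w) (hw0 : ∀ r, 2 * R ≤ r → w r = 0)
    (hw1 : ∀ r, 0 ≤ r → |deriv w r| ≤ C * r)
    (hφ : ContDiff ℝ 4 fun x : EuclideanSpace ℝ (Fin N) => w ‖x‖)
    (v : SchwartzMap (EuclideanSpace ℝ (Fin N)) ℂ) :
    ∫ x, inner ℝ (((‖x‖ ^ (-b) * ‖v x‖ ^ (p - 1) : ℝ) : ℂ) * v x)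
        (lapR (fun x : EuclideanSpace ℝ (Fin N) => w ‖x‖) x • v x +
          ∑ j, pd j (fun x : EuclideanSpace ℝ (Fin N) => w ‖x‖) x • (pd j v x + pd j v x)) =
      ∫ x, ‖x‖ ^ (-b) * ‖v x‖ ^ (p + 1) *
        ((p - 1) / (p + 1) * lapR (fun x : EuclideanSpace ℝ (Fin N) => w ‖x‖) x +
          2 * b / (p + 1) * (deriv w ‖x‖ / ‖x‖)) := by
  set φ := fun x : EuclideanSpace ℝ (Fin N) => w ‖x‖ with hφdef
  have hs : HasCompactSupport φ := hasCompactSupport_cutoff hw0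
  have hg : ContDiff ℝ 1 fun x => ‖v x‖ ^ (p + 1) := (v.smooth 1).norm_rpow (by linarith)
  have hφ1 : ∀ j, Continuous (pd j φ) := fun j =>
    (contDiff_pd (m := 3) j hφ (by norm_num)).continuous
  have hG : ∀ x, |‖v x‖ ^ (p + 1)| ≤ SchwartzMap.seminorm ℝ 0 0 v ^ (p + 1) := fun x => by
    rw [abs_of_nonneg (by positivity)]
    exact Real.rpow_le_rpow (norm_nonneg _) (SchwartzMap.norm_le_seminorm ℝ v x) (by linarith)
  have hibp := integral_rpow_neg_mul_sum_pd hN hb0 hb hC hw hw0 hw1 hφ hg hG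
  have hi1 : Integrable fun x => ‖x‖ ^ (-b) * (lapR φ x * ‖v x‖ ^ (p + 1)) :=
    integrable_rpow_neg_mul hN hb ((contDiff_lapR hφ).continuous.mul hg.continuous)
      (hasCompactSupport_lapR hs).mul_right
  have hi2 : Integrable fun x : EuclideanSpace ℝ (Fin N) =>
      ‖x‖ ^ (-b) * ∑ j, pd j φ x * pd j (fun x => ‖v x‖ ^ (p + 1)) x :=
    integrable_rpow_neg_mul hN hb (continuous_finsetSum _ fun j _ => (hφ1 j).mul
      (contDiff_pd (m := 0) j hg (by norm_num)).continuous)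
      (hasCompactSupport_sum _ fun j _ => (hasCompactSupport_pd j hs).mul_right)
  have hdw : Measurable fun x : EuclideanSpace ℝ (Fin N) => deriv w ‖x‖ / ‖x‖ :=
    ((measurable_deriv w).comp measurable_norm).div measurable_norm
  have hh : ∀ x : EuclideanSpace ℝ (Fin N), ‖deriv w ‖x‖ / ‖x‖‖ ≤ C := fun x => by
    rw [norm_div, norm_norm]
    exact div_le_of_le_mul₀ (norm_nonneg _) hC (hw1 _ (norm_nonneg _))
  have hi3 : Integrable fun x => deriv w ‖x‖ / ‖x‖ * (‖x‖ ^ (-b) * ‖v x‖ ^ (p + 1)) :=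
    (integrable_rpow_mul_norm_rpow hN hb0 hb (show 0 < p + 1 by linarith) v).bdd_mul
      hdw.aestronglyMeasurable (Eventually.of_forall hh)
  have e1 : ∀ x, inner ℝ (((‖x‖ ^ (-b) * ‖v x‖ ^ (p - 1) : ℝ) : ℂ) * v x)
      (lapR φ x • v x + ∑ j, pd j φ x • (pd j v x + pd j v x)) =
      ‖x‖ ^ (-b) * (lapR φ x * ‖v x‖ ^ (p + 1)) + 2 / (p + 1) *
        (‖x‖ ^ (-b) * ∑ j, pd j φ x * pd j (fun x => ‖v x‖ ^ (p + 1)) x) := fun x => by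
    rw [← Complex.real_smul, real_inner_smul_left, inner_add_right, inner_smul_right, inner_sum,
      real_inner_self_eq_norm_sq, ← rpow_sub_one_mul_sq hp (norm_nonneg (v x))]
    simp only [pd_norm_rpow_add_one hp (v.smooth 1), inner_smul_right, inner_add_right,
      mul_add, Finset.mul_sum]
    congr 1
    · ring
    · refine Finset.sum_congr rfl fun j _ => ?_
      have : p + 1 ≠ 0 := by linarith
      field_simp
      ring
  simp only [e1]
  rw [integral_add hi1 (hi2.const_mul _), integral_const_mul, hibp, ← integral_const_mul,
    ← integral_add hi1]
  · refine integral_congr_ae (Eventually.of_forall fun x => ?_)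
    have : p + 1 ≠ 0 := by linarith
    simp only []
    field_simp
    ring
  · refine Integrable.const_mul ?_ _
    refine ((hi1.sub (hi3.const_mul b)).neg).congr (Eventually.of_forall fun x => ?_)
    simp only [Pi.neg_apply, Pi.sub_apply]
    ring

end Nonlinear

section Estimates

variable {N : ℕ} {b p : ℝ} {w : ℝ → ℝ} {R C : ℝ}

theorem abs_lapR_cutoff_le (hN : 1 ≤ N) (hw : ContDiff ℝ 4 w)
    (hw1 : ∀ r, 0 ≤ r → |deriv w r| ≤ C * r) (hw2 : ∀ r, 0 ≤ r → |deriv (deriv w) r| ≤ C)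
    {x : EuclideanSpace ℝ (Fin N)} (hx : x ≠ 0) :
    |lapR (fun x : EuclideanSpace ℝ (Fin N) => w ‖x‖) x| ≤ N * C := by
  have hx0 := norm_pos_iff.mpr hx
  have hN' : (0 : ℝ) ≤ N - 1 := sub_nonneg.mpr (by exact_mod_cast hN)
  have h : |deriv w ‖x‖ / ‖x‖| ≤ C := by
    rw [abs_div, abs_of_pos hx0, div_le_iff₀ hx0]
    exact hw1 _ hx0.le
  rw [lapR_comp_norm (hw.of_le (by norm_num)) hx]
  calc |deriv (deriv w) ‖x‖ + (N - 1) * (deriv w ‖x‖ / ‖x‖)|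
      ≤ |deriv (deriv w) ‖x‖| + |(N - 1) * (deriv w ‖x‖ / ‖x‖)| := abs_add_le _ _
    _ ≤ C + (N - 1) * C := by
        rw [abs_mul, abs_of_nonneg hN']
        gcongr
        exact hw2 _ hx0.le
    _ = N * C := by ring

theorem integral_hessian_sub_bilaplacian_le (hN : 1 ≤ N) (hR : 0 < R) (hw : ContDiff ℝ 4 w)
    (hwR : ∀ r ∈ Icc (0 : ℝ) R, w r = r ^ 2) (hw0 : ∀ r, 2 * R ≤ r → w r = 0)
    (hw2 : ∀ r, 0 ≤ r → deriv (deriv w) r ≤ 2)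
    (hφ : ContDiff ℝ 4 fun x : EuclideanSpace ℝ (Fin N) => w ‖x‖)
    (hΔ : ∀ x, |lapR (lapR (fun x : EuclideanSpace ℝ (Fin N) => w ‖x‖)) x| ≤ C)
    (v : SchwartzMap (EuclideanSpace ℝ (Fin N)) ℂ) :
    ∫ x, (4 * ∑ j, ∑ i, pd j (pd i (fun x : EuclideanSpace ℝ (Fin N) => w ‖x‖)) x *
        inner ℝ (pd j v x) (pd i v x) -
          lapR (lapR (fun x : EuclideanSpace ℝ (Fin N) => w ‖x‖)) x * ‖v x‖ ^ 2) ≤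
      8 * (∫ x, gradNormSq v x) + C * ∫ x, ‖v x‖ ^ 2 := by
  set φ := fun x : EuclideanSpace ℝ (Fin N) => w ‖x‖ with hφdef
  have hs : HasCompactSupport φ := hasCompactSupport_cutoff hw0
  have hv1 : ∀ j, Continuous (pd j v) := fun j =>
    (contDiff_pd (m := 0) j (v.smooth 1) (by norm_num)).continuous
  have hφ2 : ∀ j i, Continuous (pd j (pd i φ)) := fun j i => (contDiff_pd (m := 2) j
    (contDiff_pd (m := 3) i hφ (by norm_num)) (by norm_num)).continuous
  have hi1 : Integrable fun x => ∑ j, ∑ i, pd j (pd i φ) x * inner ℝ (pd j v x) (pd i v x) :=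
    integrable_finsetSum _ fun j _ => integrable_finsetSum _ fun i _ =>
      ((hφ2 j i).mul ((hv1 j).inner (hv1 i))).integrable_of_hasCompactSupport
        (hasCompactSupport_pd j (hasCompactSupport_pd i hs)).mul_right
  have hΔc : Continuous (lapR (lapR φ)) := continuous_lapR (contDiff_lapR hφ)
  have hi2 : Integrable fun x => lapR (lapR φ) x * ‖v x‖ ^ 2 :=
    (hΔc.mul (v.continuous.norm.pow 2)).integrable_of_hasCompactSupport
      (hasCompactSupport_lapR (hasCompactSupport_lapR hs)).mul_right
  rw [← integral_const_mul, ← integral_const_mul, ← integral_add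
    ((integrable_gradNormSq v).const_mul _) ((integrable_norm_sq_schwartz v).const_mul _)]
  refine integral_mono_ae ((hi1.const_mul 4).sub hi2) (((integrable_gradNormSq v).const_mul _).add
    ((integrable_norm_sq_schwartz v).const_mul _)) ?_
  filter_upwards [ae_ne_zero hN] with x hx
  have hx0 := norm_pos_iff.mpr hx
  have h1 := sum_hessian_comp_norm_le (hw.of_le (by norm_num)) hx (hw2 _ hx0.le)
    ((div_le_iff₀ hx0).mpr (cutoff_deriv_le hR hw hwR hw2 hx0.le)) (fun j => pd j v x)
  have h2 : -(lapR (lapR φ) x) * ‖v x‖ ^ 2 ≤ C * ‖v x‖ ^ 2 := by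
    gcongr
    exact (neg_le_abs _).trans (hΔ x)
  rw [← gradNormSq_eq] at h1
  change 4 * _ - _ ≤ 8 * gradNormSq v x + C * ‖v x‖ ^ 2
  linarith

theorem neg_two_mul_integral_nonlinear_le (hN : 1 ≤ N) (hb0 : 0 < b) (hb : b < N) (hp : 1 < p)
    (hR : 0 < R) (hC : 0 ≤ C) (hw : ContDiff ℝ 4 w)
    (hwR : ∀ r ∈ Icc (0 : ℝ) R, w r = r ^ 2)
    (hw2 : ∀ r, 0 ≤ r → |deriv (deriv w) r| ≤ C)
    (hφ : ContDiff ℝ 4 fun x : EuclideanSpace ℝ (Fin N) => w ‖x‖)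
    (v : SchwartzMap (EuclideanSpace ℝ (Fin N)) ℂ) :
    -2 * ∫ x, ‖x‖ ^ (-b) * ‖v x‖ ^ (p + 1) *
        ((p - 1) / (p + 1) * lapR (fun x : EuclideanSpace ℝ (Fin N) => w ‖x‖) x +
          2 * b / (p + 1) * (deriv w ‖x‖ / ‖x‖)) ≤
      -8 * ((N * (p - 1) + 2 * b) / (2 * (p + 1))) * (∫ x, ‖x‖ ^ (-b) * ‖v x‖ ^ (p + 1)) +
        (2 * C + 4) * ((N * (p - 1) + 2 * b) / (p + 1)) * R ^ (-b) *
          ∫ x, ‖v x‖ ^ (p + 1) := by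
  set φ := fun x : EuclideanSpace ℝ (Fin N) => w ‖x‖ with hφdef
  have hp1 : 0 < p + 1 := by linarith
  have hw1 : ∀ r, 0 ≤ r → |deriv w r| ≤ C * r := fun r hr => abs_cutoff_deriv_le hR hw hwR hw2 hr
  have hq := integrable_rpow_mul_norm_rpow hN hb0 hb hp1 v
  have hv := integrable_norm_rpow_schwartz v hp1
  set κ := (N * (p - 1) + 2 * b) / (p + 1) with hκ
  have hκ0 : 0 ≤ κ := by
    have : 0 ≤ p - 1 := by linarith
    positivity
  set Ψ := fun x : EuclideanSpace ℝ (Fin N) =>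
    (p - 1) / (p + 1) * lapR φ x + 2 * b / (p + 1) * (deriv w ‖x‖ / ‖x‖) with hΨ
  have hΨm : Measurable Ψ := ((contDiff_lapR hφ).continuous.measurable.const_mul _).add
    ((((measurable_deriv w).comp measurable_norm).div measurable_norm).const_mul _)
  have hΨC : ∀ x, x ≠ 0 → |Ψ x| ≤ C * κ := fun x hx => by
    have hx0 := norm_pos_iff.mpr hx
    have h1 := abs_lapR_cutoff_le hN hw hw1 hw2 hx
    have h2 : |deriv w ‖x‖ / ‖x‖| ≤ C := by
      rw [abs_div, abs_of_pos hx0, div_le_iff₀ hx0]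
      exact hw1 _ hx0.le
    have h3 : 0 ≤ (p - 1) / (p + 1) := div_nonneg (by linarith) hp1.le
    have h4 : 0 ≤ 2 * b / (p + 1) := by positivity
    calc |Ψ x| ≤ |(p - 1) / (p + 1) * lapR φ x| + |2 * b / (p + 1) * (deriv w ‖x‖ / ‖x‖)| :=
          abs_add_le _ _
      _ ≤ (p - 1) / (p + 1) * (N * C) + 2 * b / (p + 1) * C := by
          rw [abs_mul, abs_mul, abs_of_nonneg h3, abs_of_nonneg h4]
          gcongr
      _ = C * κ := by rw [hκ]; ring
  have hΨR : ∀ x, x ≠ 0 → ‖x‖ ≤ R → Ψ x = 2 * κ := fun x hx hxR => by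
    have hx0 := norm_pos_iff.mpr hx
    have hmem : ‖x‖ ∈ Icc 0 R := ⟨hx0.le, hxR⟩
    simp only [hΨ, hφdef, lapR_comp_norm (hw.of_le (by norm_num)) hx, cutoff_deriv hR hw hwR hmem,
      cutoff_deriv_deriv hR hw hwR hmem, hκ]
    field_simp
    ring
  have hi : Integrable fun x => ‖x‖ ^ (-b) * ‖v x‖ ^ (p + 1) * Ψ x := by
    refine hq.mul_bdd (c := C * κ) hΨm.aestronglyMeasurable ?_
    filter_upwards [ae_ne_zero hN] with x hx using hΨC x hx
  rw [← integral_const_mul, ← integral_const_mul, ← integral_const_mul,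
    ← integral_add (hq.const_mul _) (hv.const_mul _)]
  refine integral_mono_ae (hi.const_mul _) ((hq.const_mul _).add (hv.const_mul _)) ?_
  filter_upwards [ae_ne_zero hN] with x hx
  have hv0 : 0 ≤ ‖v x‖ ^ (p + 1) := by positivity
  have e1 : -8 * ((N * (p - 1) + 2 * b) / (2 * (p + 1))) = -4 * κ := by
    rw [hκ]
    field_simp
    ring
  rw [e1]
  change -2 * (‖x‖ ^ (-b) * ‖v x‖ ^ (p + 1) * Ψ x) ≤ _
  rcases le_or_gt ‖x‖ R with hxR | hxR
  · rw [hΨR x hx hxR]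
    have : 0 ≤ (2 * C + 4) * κ * R ^ (-b) * ‖v x‖ ^ (p + 1) := by positivity
    linarith
  · have h1 : ‖x‖ ^ (-b) ≤ R ^ (-b) :=
      Real.rpow_le_rpow_of_nonpos hR hxR.le (by linarith)
    have h2 : -Ψ x ≤ C * κ := (neg_le_abs _).trans (hΨC x hx)
    have h3 : ‖x‖ ^ (-b) * ‖v x‖ ^ (p + 1) ≤ R ^ (-b) * ‖v x‖ ^ (p + 1) := by gcongr
    have h4 : 0 ≤ ‖x‖ ^ (-b) * ‖v x‖ ^ (p + 1) := by positivity
    have h5 : 0 ≤ 2 * C * κ + 4 * κ := by positivity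
    nlinarith [mul_le_mul_of_nonneg_left h2 h4, mul_le_mul_of_nonneg_left h3 h5]

theorem rpow_le_rpow_sub_one_mul {G C₀ α : ℝ} (hC₀ : 0 < C₀) (hG : C₀ ≤ G) (hα : α ≤ 1) :
    G ^ α ≤ C₀ ^ (α - 1) * G := by
  have hG0 : 0 < G := hC₀.trans_le hG
  calc G ^ α = G ^ (α - 1) * G := by rw [Real.rpow_sub_one hG0.ne', div_mul_cancel₀ _ hG0.ne']
    _ ≤ C₀ ^ (α - 1) * G := mul_le_mul_of_nonneg_right
        (Real.rpow_le_rpow_of_nonpos hC₀ hG (by linarith)) hG0.le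

theorem exists_forall_le_add_mul_rpow_neg_le (A B : ℝ) (hb : 0 < b) {δ : ℝ} (hδ : 0 < δ) :
    ∃ R₀ : ℝ, 0 < R₀ ∧ ∀ R, R₀ ≤ R → A / R ^ 2 + B * R ^ (-b) ≤ δ := by
  have h1 : Tendsto (fun R : ℝ => A / R ^ 2) atTop (𝓝 0) :=
    tendsto_const_nhds.div_atTop (tendsto_pow_atTop two_ne_zero)
  have h2 : Tendsto (fun R : ℝ => B * R ^ (-b)) atTop (𝓝 (B * 0)) :=
    (tendsto_rpow_neg_atTop hb).const_mul B
  have h3 := h1.add h2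
  rw [mul_zero, add_zero] at h3
  obtain ⟨R₁, hR₁⟩ := eventually_atTop.mp (h3.eventually_le_const hδ)
  exact ⟨max R₁ 1, by positivity, fun R hR => hR₁ R ((le_max_left _ _).trans hR)⟩

theorem integral_inner_lap_add_nonlinearity_dilation (hN : 1 ≤ N) (hb : b < N)
    (hp : 1 < p) {φ : EuclideanSpace ℝ (Fin N) → ℝ} (hφ : ContDiff ℝ 4 φ)
    (hs : HasCompactSupport φ) (v : SchwartzMap (EuclideanSpace ℝ (Fin N)) ℂ) :
    ∫ x, inner ℝ (lap v x + ((‖x‖ ^ (-b) * ‖v x‖ ^ (p - 1) : ℝ) : ℂ) * v x)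
        (lapR φ x • v x + ∑ j, pd j φ x • (pd j v x + pd j v x)) =
      (∫ x, inner ℝ (lap v x) (lapR φ x • v x + ∑ j, pd j φ x • (pd j v x + pd j v x))) +
        ∫ x, inner ℝ (((‖x‖ ^ (-b) * ‖v x‖ ^ (p - 1) : ℝ) : ℂ) * v x)
          (lapR φ x • v x + ∑ j, pd j φ x • (pd j v x + pd j v x)) := by
  have hv1 : ∀ j, Continuous (pd j v) := fun j =>
    (contDiff_pd (m := 0) j (v.smooth 1) (by norm_num)).continuous
  have hφ1 : ∀ j, Continuous (pd j φ) := fun j =>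
    (contDiff_pd (m := 3) j hφ (by norm_num)).continuous
  have hDc : Continuous fun x => lapR φ x • v x + ∑ j, pd j φ x • (pd j v x + pd j v x) :=
    ((contDiff_lapR hφ).continuous.smul v.continuous).add
      (continuous_finsetSum _ fun j _ => (hφ1 j).smul ((hv1 j).add (hv1 j)))
  have hDs : HasCompactSupport fun x =>
      lapR φ x • v x + ∑ j, pd j φ x • (pd j v x + pd j v x) :=
    (hasCompactSupport_lapR hs).smul_right.add
      (hasCompactSupport_sum _ fun j _ => (hasCompactSupport_pd j hs).smul_right)
  have hinner : ∀ {f : EuclideanSpace ℝ (Fin N) → ℂ}, HasCompactSupport fun x => inner ℝ (f x)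
      (lapR φ x • v x + ∑ j, pd j φ x • (pd j v x + pd j v x)) := fun {f} =>
    hDs.mono fun x hx h0 => hx (by simp only [h0, inner_zero_right])
  simp only [inner_add_left]
  refine integral_add (((continuous_lap (v.smooth 2)).inner hDc).integrable_of_hasCompactSupport
    hinner) ?_
  have hk : Continuous fun x => inner ℝ (‖v x‖ ^ (p - 1) • v x)
      (lapR φ x • v x + ∑ j, pd j φ x • (pd j v x + pd j v x)) :=
    ((continuous_norm_rpow_schwartz v (by linarith)).smul v.continuous).inner hDc
  refine (integrable_rpow_neg_mul hN hb hk hinner).congr (Eventually.of_forall fun x => ?_)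
  simp only [← Complex.real_smul, mul_smul, real_inner_smul_left]

end Estimates

/-- Virial estimate in the case `1 + (4−2b)/N < p ≤ 1 + 4/N` (so
`α̃ = N(p−1)/4 ∈ (0,1]`): there is `R₀ > 0`, depending only on `N, p, b, δ₀, C₀, M₁, C₁, C₃`,
such that for every classical Schwartz solution of (INLS) on an interval `J` satisfying
(i) `K(u(t)) ≤ −δ₀‖∇u(t)‖²`, (ii) `‖∇u(t)‖² ≥ C₀`, (iii) `‖u(t)‖² ≤ M₁`,
(iv) `‖u(t)‖_{p+1}^{p+1} ≤ C₁‖∇u(t)‖^{2α̃}`, and every radius `R ≥ R₀` with an admissible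
cutoff `w`, the localized virial quantity `I(t) = ∫ w(|x|)|u(t,·)|² dx` satisfies
`I''(t) ≤ −4δ₀‖∇u(t)‖²` on `J`. -/
theorem stmt16 (N : ℕ) (hN : 1 ≤ N) (b p δ₀ C₀ M₁ C₁ C₃ : ℝ)
    (hb1 : 0 < b) (hb2 : b < min 2 (N : ℝ))
    (hp1 : 1 + (4 - 2 * b) / N < p) (hp2 : p ≤ 1 + 4 / N)
    (hδ : 0 < δ₀) (hC₀ : 0 < C₀) (hM : 0 < M₁) (hC₁ : 0 < C₁) (hC₃ : 0 < C₃) :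
    ∃ R₀ : ℝ, 0 < R₀ ∧
      ∀ (J : Set ℝ), J.OrdConnected → ∀ sol : INLSSolution N b p J,
      (∀ t ∈ J, Kq N b p (fun y => sol.u t y) ≤
        -δ₀ * ∫ x : EuclideanSpace ℝ (Fin N), gradNormSq (fun y => sol.u t y) x) →
      (∀ t ∈ J, C₀ ≤ ∫ x : EuclideanSpace ℝ (Fin N), gradNormSq (fun y => sol.u t y) x) →
      (∀ t ∈ J, ∫ x : EuclideanSpace ℝ (Fin N), ‖sol.u t x‖ ^ 2 ≤ M₁) →
      (∀ t ∈ J, ∫ x : EuclideanSpace ℝ (Fin N), ‖sol.u t x‖ ^ (p + 1) ≤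
        C₁ * (∫ x : EuclideanSpace ℝ (Fin N), gradNormSq (fun y => sol.u t y) x) ^
          ((N : ℝ) * (p - 1) / 4)) →
      ∀ R : ℝ, R₀ ≤ R → ∀ w : ℝ → ℝ,
        ContDiff ℝ 4 w →
        (∀ r ∈ Icc (0:ℝ) R, w r = r ^ 2) →
        (∀ r : ℝ, 2 * R ≤ r → w r = 0) →
        (∀ r : ℝ, 0 ≤ r → deriv (deriv w) r ≤ 2 ∧ |deriv (deriv w) r| ≤ C₃) →
        ContDiff ℝ 4 (fun x : EuclideanSpace ℝ (Fin N) => w ‖x‖) →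
        (∀ x : EuclideanSpace ℝ (Fin N),
          |lapR (lapR (fun y : EuclideanSpace ℝ (Fin N) => w ‖y‖)) x| ≤ C₃ / R ^ 2) →
        ∃ I' : ℝ → ℝ,
          (∀ t ∈ J,
            HasDerivWithinAt
              (fun s => ∫ x : EuclideanSpace ℝ (Fin N), w ‖x‖ * ‖sol.u s x‖ ^ 2)
              (I' t) J t) ∧
          (∀ t ∈ J, ∃ d : ℝ, HasDerivWithinAt I' d J t ∧
            d ≤ -4 * δ₀ *
              ∫ x : EuclideanSpace ℝ (Fin N), gradNormSq (fun y => sol.u t y) x) := by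
  have hb : b < N := hb2.trans_le (min_le_right _ _)
  have hN0 : (0 : ℝ) < N := by exact_mod_cast hN
  have hp : 1 < p := by
    have : 0 < (4 - 2 * b) / N := div_pos (by linarith [hb2.trans_le (min_le_left _ _)]) hN0
    linarith
  set α := (N : ℝ) * (p - 1) / 4 with hα_def
  have hα : α ≤ 1 := by
    have : p - 1 ≤ 4 / N := by linarith
    rw [le_div_iff₀ hN0] at this
    rw [hα_def]
    linarith
  set κ := (2 * C₃ + 4) * ((N * (p - 1) + 2 * b) / (p + 1)) with hκ
  have hκ0 : 0 ≤ κ := by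
    have : 0 < p - 1 := by linarith
    positivity
  obtain ⟨R₀, hR₀, hsmall⟩ := exists_forall_le_add_mul_rpow_neg_le (C₃ * M₁ / C₀)
    (κ * (C₁ * C₀ ^ (α - 1))) hb1 (show 0 < 4 * δ₀ by positivity)
  refine ⟨R₀, hR₀, fun J hJ sol hi hii hiii hiv R hR w hw hwR hw0 hw2 hφ hΔ => ?_⟩
  have hRpos : 0 < R := hR₀.trans_le hR
  have hs : HasCompactSupport fun x : EuclideanSpace ℝ (Fin N) => w ‖x‖ :=
    hasCompactSupport_cutoff hw0
  refine ⟨fun t => -2 * momentum (fun x : EuclideanSpace ℝ (Fin N) => w ‖x‖) (sol.u t),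
    fun t ht => sol.hasDerivWithinAt_integral_mul_norm_sq hN hb hp hJ ht hφ hs, fun t ht =>
    ⟨_, (sol.hasDerivWithinAt_momentum hN hb hp hJ ht hφ hs).const_mul (-2), ?_⟩⟩
  have hw1 : ∀ r, 0 ≤ r → |deriv w r| ≤ C₃ * r := fun r hr =>
    abs_cutoff_deriv_le hRpos hw hwR (fun r hr => (hw2 r hr).2) hr
  rw [integral_inner_lap_add_nonlinearity_dilation hN hb hp hφ hs, mul_add, ← integral_const_mul,
    integral_inner_lap_dilation hφ hs ((sol.u t).smooth 4),
    integral_inner_nonlinearity_dilation hN hb1 hb hp hC₃.le hw hw0 hw1 hφ]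
  have h1 := integral_hessian_sub_bilaplacian_le hN hRpos hw hwR hw0 (fun r hr => (hw2 r hr).1)
    hφ hΔ (sol.u t)
  have h2 := neg_two_mul_integral_nonlinear_le hN hb1 hb hp hRpos hC₃.le hw hwR
    (fun r hr => (hw2 r hr).2) hφ (sol.u t)
  have hK := hi t ht
  have hG := hii t ht
  have hM' := hiii t ht
  have hC := hiv t ht
  rw [Kq] at hK
  set G := ∫ x : EuclideanSpace ℝ (Fin N), gradNormSq (fun y => sol.u t y) x
  have hG0 : 0 ≤ G := hC₀.le.trans hG
  have h3 : C₃ / R ^ 2 * ∫ x, ‖sol.u t x‖ ^ 2 ≤ C₃ * M₁ / C₀ / R ^ 2 * G := by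
    calc C₃ / R ^ 2 * ∫ x, ‖sol.u t x‖ ^ 2 ≤ C₃ / R ^ 2 * M₁ := by gcongr
      _ = C₃ * M₁ / C₀ / R ^ 2 * C₀ := by field_simp
      _ ≤ C₃ * M₁ / C₀ / R ^ 2 * G := by gcongr
  have h4 : κ * R ^ (-b) * ∫ x, ‖sol.u t x‖ ^ (p + 1) ≤
      κ * (C₁ * C₀ ^ (α - 1)) * R ^ (-b) * G := by
    calc κ * R ^ (-b) * ∫ x, ‖sol.u t x‖ ^ (p + 1)
        ≤ κ * R ^ (-b) * (C₁ * (C₀ ^ (α - 1) * G)) := by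
          gcongr
          exact hC.trans (mul_le_mul_of_nonneg_left (rpow_le_rpow_sub_one_mul hC₀ hG hα) hC₁.le)
      _ = κ * (C₁ * C₀ ^ (α - 1)) * R ^ (-b) * G := by ring
  have h5 := mul_le_mul_of_nonneg_right (hsmall R hR) hG0
  change _ ≤ 8 * G + _ at h1
  linarith
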